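/- arXiv:1908.10070 — 4 statements merged into one kernel-verified Lean document; each statement's English description precedes it below -/
import Mathlib

section
/- Let m and n be even positive integers, let W be an m×m symmetric unitary complex matrix, and set f_n := n!·C((m+n)/2−1, n/2). For x = (x_1,…,x_n) ∈ {1,…,m}^n let q_n(x) := |Haf(W_x)|²/f_n. Fix 1 ≤ k ≤ n and x_1,…,x_k ∈ {1,…,m}, and let q_n(x_1,…,x_k) := ∑_{x_{k+1},…,x_n ∈ {1,…,m}} q_n(x_1,…,x_n) be the marginal. Then q_n(x_1,…,x_k) = ∑_{j_1,j_2} ∑_{a,a'} Haf(R_a)·Haf(conj(R_{a'})) · ∑_{μ∈S_μ} F^{(μ)}_{j_1,j_2} · ∑_{A,B} Per(S_{A,B})·Haf(R_e)·Haf(conj(R_{e'})), where: j_1 and j_2 range over integers from max(0, k−n/2) to ⌊k/2⌋; a ranges over all 2j_1-element subsets of the index set {1,…,k} and a' over all 2j_2-element subsets of {1,…,k}; S_μ := {μ ∈ ℕ : 3k−2(j_1+j_2)−n ≤ μ ≤ k−2·max(j_1,j_2) and μ ≡ k (mod 2)}; A ranges over all μ-element subsets of {1,…,k}∖a and B over all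 μ-element subsets of {1,…,k}∖a'; e := {1,…,k}∖(a∪A) and e' := {1,…,k}∖(a'∪B); for an index set c ⊆ {1,…,k}, R_c denotes the matrix (W(x_i,x_j))_{i,j∈c} (indices in increasing order); S_{A,B} is the μ×μ matrix with S_{A,B}(i,j) = 1 if x_{A_i} = x_{B_j} and 0 otherwise, where A and B are listed in increasing order; and F^{(μ)}_{j_1,j_2} := ((n−k)!/f_n)·C((n−k+μ+m)/2 − 1, k − j_1 − j_2 + m/2 − 1). -/
/-- The Hafnian of a matrix over a linearly ordered finite index type, defined as the sum
over all perfect matchings (fixed-point-free involutions) of the products of entries over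
the matched pairs. -/
noncomputable def hafnian {ι : Type*} [Fintype ι] [LinearOrder ι] (V : Matrix ι ι ℂ) : ℂ :=
  ∑ π ∈ Finset.univ.filter (fun π : Equiv.Perm ι => ∀ i, π (π i) = i ∧ π i ≠ i),
    ∏ i ∈ Finset.univ.filter (fun i => i < π i), V i (π i)

/-- The permanent of a (square) matrix, as the sum over all bijections between the row and
column index sets of the products of the selected entries; it is `0` if the index sets have
different cardinalities. -/
noncomputable def perm {ι κ : Type*} [Fintype ι] [Fintype κ] [DecidableEq ι] [DecidableEq κ]
    (M : Matrix ι κ ℂ) : ℂ :=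
  ∑ σ : ι ≃ κ, ∏ i, M i (σ i)

section
variable {ι κ R : Type*} [CommRing R] [LinearOrder ι] [LinearOrder κ]

/-- The sum over perfect matchings of a finite set `S` of the products of the weights `V i j` over
the matched pairs; a matching is encoded as an involution moving exactly the points of `S`. -/
def matchingSum (V : ι → ι → R) (S : Finset ι) : R :=
  ∑ π ∈ (permsOfFinset S).filter (fun π => ∀ i ∈ S, π (π i) = i ∧ π i ≠ i),
    ∏ i ∈ S, if i < π i then V i (π i) else 1

@[simp] lemma matchingSum_empty (V : ι → ι → R) : matchingSum V ∅ = 1 := by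
  have : permsOfFinset (∅ : Finset ι) = {1} := by
    ext π
    simp only [mem_perms_of_finset_iff, Finset.notMem_empty, Finset.mem_singleton]
    exact ⟨fun h => Equiv.ext fun i => by simpa using @h i, fun h => by simp [h]⟩
  simp [matchingSum, this]

lemma mem_matchings_iff {S : Finset ι} {π : Equiv.Perm ι} :
    π ∈ (permsOfFinset S).filter (fun π => ∀ i ∈ S, π (π i) = i ∧ π i ≠ i) ↔
      (∀ i, π (π i) = i) ∧ ∀ i, π i ≠ i ↔ i ∈ S := by
  rw [Finset.mem_filter, mem_perms_of_finset_iff]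
  constructor
  · rintro ⟨h1, h2⟩
    refine ⟨fun i => ?_, fun i => ⟨fun h => h1 h, fun h => (h2 i h).2⟩⟩
    by_cases hi : i ∈ S
    · exact (h2 i hi).1
    · have : π i = i := by_contra fun h => hi (h1 h)
      rw [this, this]
  · rintro ⟨h1, h2⟩
    exact ⟨fun h => (h2 _).1 h, fun i hi => ⟨h1 i, (h2 i).2 hi⟩⟩

lemma swap_mul_mem_matchings {S : Finset ι} {π : Equiv.Perm ι} {u v : ι}
    (h1 : ∀ i, π (π i) = i) (h2 : ∀ i, π i ≠ i ↔ i ∈ S) (huv : u ≠ v) (hu : π u = v) :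
    (∀ i, (Equiv.swap u v * π) ((Equiv.swap u v * π) i) = i) ∧
      ∀ i, (Equiv.swap u v * π) i ≠ i ↔ i ∈ (S.erase u).erase v := by
  have hv : π v = u := by rw [← hu, h1]
  have key : ∀ i, i ≠ u → i ≠ v → (Equiv.swap u v * π) i = π i := by
    intro i hiu hiv
    rw [Equiv.Perm.mul_apply]
    apply Equiv.swap_apply_of_ne_of_ne
    · intro h; exact hiv (π.injective (h.trans hv.symm))
    · intro h; exact hiu (π.injective (h.trans hu.symm))
  have ku : (Equiv.swap u v * π) u = u := by simp [hu]
  have kv : (Equiv.swap u v * π) v = v := by simp [hv]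
  constructor
  · intro i
    by_cases hiu : i = u
    · rw [hiu, ku, ku]
    by_cases hiv : i = v
    · rw [hiv, kv, kv]
    rw [key i hiu hiv, key, h1]
    · intro h; exact hiv (π.injective (h.trans hv.symm))
    · intro h; exact hiu (π.injective (h.trans hu.symm))
  · intro i
    by_cases hiu : i = u
    · subst hiu; simp [hu]
    by_cases hiv : i = v
    · subst hiv; simp [hv]
    rw [key i hiu hiv, h2]
    simp [hiu, hiv]

lemma swap_mul_mem_matchings_insert {S : Finset ι} {π : Equiv.Perm ι} {u v : ι}
    (huv : u ≠ v) (hu : u ∈ S) (hv : v ∈ S)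
    (h1 : ∀ i, π (π i) = i) (h2 : ∀ i, π i ≠ i ↔ i ∈ (S.erase u).erase v) :
    (∀ i, (Equiv.swap u v * π) ((Equiv.swap u v * π) i) = i) ∧
      (∀ i, (Equiv.swap u v * π) i ≠ i ↔ i ∈ S) ∧ (Equiv.swap u v * π) u = v := by
  have pu : π u = u := by
    by_contra h; have := (h2 u).1 h; simp at this
  have pv : π v = v := by
    by_contra h; have := (h2 v).1 h; simp at this
  have key : ∀ i, i ≠ u → i ≠ v → (Equiv.swap u v * π) i = π i := by
    intro i hiu hiv
    rw [Equiv.Perm.mul_apply]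
    apply Equiv.swap_apply_of_ne_of_ne
    · intro h; exact hiu (π.injective (h.trans pu.symm))
    · intro h; exact hiv (π.injective (h.trans pv.symm))
  have ku : (Equiv.swap u v * π) u = v := by simp [pu]
  have kv : (Equiv.swap u v * π) v = u := by simp [pv]
  refine ⟨fun i => ?_, fun i => ?_, ku⟩
  · by_cases hiu : i = u
    · rw [hiu, ku, kv]
    by_cases hiv : i = v
    · rw [hiv, kv, ku]
    rw [key i hiu hiv, key, h1]
    · intro h; exact hiu (π.injective (h.trans pu.symm))
    · intro h; exact hiv (π.injective (h.trans pv.symm))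
  · by_cases hiu : i = u
    · rw [hiu, ku]; simp [hu, huv.symm]
    by_cases hiv : i = v
    · rw [hiv, kv]; simp [hv, huv]
    rw [key i hiu hiv, h2]
    simp [hiu, hiv]

lemma matchingSum_eq_sum_erase (V : ι → ι → R) (hV : ∀ i j, V i j = V j i) {S : Finset ι} {u : ι}
    (hu : u ∈ S) :
    matchingSum V S = ∑ v ∈ S.erase u, V u v * matchingSum V ((S.erase u).erase v) := by
  unfold matchingSum
  rw [← Finset.sum_fiberwise_of_maps_to (t := S.erase u) (g := fun π => π u)]
  swap
  · intro π hπ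
    obtain ⟨h1, h2⟩ := mem_matchings_iff.1 hπ
    refine Finset.mem_erase.2 ⟨(h2 u).2 hu, (h2 _).1 ?_⟩
    rw [h1]
    exact ((h2 u).2 hu).symm
  refine Finset.sum_congr rfl fun v hv => ?_
  obtain ⟨hvu, hvS⟩ := Finset.mem_erase.1 hv
  rw [Finset.mul_sum]
  refine Finset.sum_bij' (fun π _ => Equiv.swap u v * π) (fun π _ => Equiv.swap u v * π)
    ?_ ?_ ?_ ?_ ?_
  · intro π hπ
    obtain ⟨h, hπu⟩ := Finset.mem_filter.1 hπ
    obtain ⟨h1, h2⟩ := mem_matchings_iff.1 h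
    exact mem_matchings_iff.2 (swap_mul_mem_matchings h1 h2 hvu.symm hπu)
  · intro π hπ
    obtain ⟨h1, h2⟩ := mem_matchings_iff.1 hπ
    obtain ⟨h3, h4, h5⟩ := swap_mul_mem_matchings_insert hvu.symm hu hvS h1 h2
    exact Finset.mem_filter.2 ⟨mem_matchings_iff.2 ⟨h3, h4⟩, h5⟩
  · intro π _
    simp [← mul_assoc]
  · intro π _
    simp [← mul_assoc]
  · intro π hπ
    obtain ⟨h, hπu⟩ := Finset.mem_filter.1 hπ
    obtain ⟨h1, h2⟩ := mem_matchings_iff.1 h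
    have hπv : π v = u := by rw [← hπu, h1]
    rw [← Finset.mul_prod_erase S _ hu, ← Finset.mul_prod_erase (S.erase u) _ hv, ← mul_assoc]
    congr 1
    · rw [hπu, hπv]
      rcases lt_or_gt_of_ne hvu with h | h
      · simp [h, h.not_gt, hV u v]
      · simp [h, h.not_gt]
    · refine Finset.prod_congr rfl fun i hi => ?_
      simp only [Finset.mem_erase] at hi
      rw [Equiv.Perm.mul_apply, Equiv.swap_apply_of_ne_of_ne]
      · intro h; exact hi.1 (π.injective (h.trans hπv.symm))
      · intro h; exact hi.2.1 (π.injective (h.trans hπu.symm))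

lemma matchingSum_insert (V : ι → ι → R) (hV : ∀ i j, V i j = V j i) {S : Finset ι} {u : ι}
    (hu : u ∉ S) :
    matchingSum V (insert u S) = ∑ v ∈ S, V u v * matchingSum V (S.erase v) := by
  rw [matchingSum_eq_sum_erase V hV (Finset.mem_insert_self u S), Finset.erase_insert hu]

lemma matchingSum_congr {V V' : ι → ι → R} {S : Finset ι}
    (h : ∀ i ∈ S, ∀ j ∈ S, V i j = V' i j) : matchingSum V S = matchingSum V' S := by
  refine Finset.sum_congr rfl fun π hπ => Finset.prod_congr rfl fun i hi => ?_
  obtain ⟨h1, h2⟩ := mem_matchings_iff.1 hπ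
  rw [h i hi (π i)]
  apply (h2 _).1
  rw [h1]
  exact ((h2 i).2 hi).symm

lemma matchingSum_map_ringHom {R' : Type*} [CommRing R'] (φ : R →+* R') (V : ι → ι → R)
    (S : Finset ι) : matchingSum (fun i j => φ (V i j)) S = φ (matchingSum V S) := by
  simp [matchingSum, map_sum, map_prod, apply_ite φ]

lemma matchingSum_map (f : ι ↪ κ) (V : κ → κ → R) (hV : ∀ i j, V i j = V j i) (S : Finset ι) :
    matchingSum V (S.map f) = matchingSum (fun i j => V (f i) (f j)) S := by
  induction S using Finset.strongInduction with
  | H S ih =>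
    obtain rfl | ⟨u, hu⟩ := S.eq_empty_or_nonempty
    · simp
    · rw [matchingSum_eq_sum_erase V hV (Finset.mem_map_of_mem f hu),
        matchingSum_eq_sum_erase _ (fun i j => hV _ _) hu, ← Finset.map_erase, Finset.sum_map]
      refine Finset.sum_congr rfl fun v hv => ?_
      rw [← Finset.map_erase, ih]
      exact (Finset.erase_subset _ _).trans_ssubset (Finset.erase_ssubset hu)

lemma sum_sum_erase_mul_matchingSum (V : ι → ι → R) (hV : ∀ i j, V i j = V j i) (S : Finset ι) :
    ∑ u ∈ S, ∑ v ∈ S.erase u, V u v * matchingSum V ((S.erase u).erase v) =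
      S.card * matchingSum V S := by
  rw [Finset.sum_congr rfl fun u hu => (matchingSum_eq_sum_erase V hV hu).symm]
  simp

end

section

lemma hafnian_eq_matchingSum_univ {ι : Type*} [Fintype ι] [LinearOrder ι] (V : Matrix ι ι ℂ) :
    hafnian V = matchingSum V Finset.univ := by
  unfold hafnian matchingSum
  have : permsOfFinset (Finset.univ : Finset ι) = Finset.univ := by
    ext π; simp [mem_perms_of_finset_iff]
  simp [this, Finset.prod_filter]

lemma hafnian_subtype {ι : Type*} [LinearOrder ι] (V : ι → ι → ℂ) (hV : ∀ i j, V i j = V j i)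
    (S : Finset ι) : hafnian (fun i j : ↥S => V i j) = matchingSum V S := by
  refine (hafnian_eq_matchingSum_univ _).trans ?_
  refine (matchingSum_map (Function.Embedding.subtype (· ∈ S)) V hV Finset.univ).symm.trans ?_
  congr 1
  ext i
  simp

end

section
variable {ι κ R : Type*} [CommRing R]

lemma sum_powerset_sum_mem {A : Type*} [AddCommMonoid A] [DecidableEq ι] (Q : Finset ι)
    (f : ι → Finset ι → A) :
    ∑ B ∈ Q.powerset, ∑ v ∈ B, f v (B.erase v) =
      ∑ v ∈ Q, ∑ B ∈ (Q.erase v).powerset, f v B := by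
  rw [Finset.sum_sigma', Finset.sum_sigma']
  refine Finset.sum_bij' (fun p _ => ⟨p.2, p.1.erase p.2⟩) (fun p _ => ⟨insert p.1 p.2, p.1⟩)
    ?_ ?_ ?_ ?_ ?_
  · rintro ⟨B, v⟩ h
    simp only [Finset.mem_sigma, Finset.mem_powerset] at h ⊢
    exact ⟨h.1 h.2, Finset.erase_subset_erase _ h.1⟩
  · rintro ⟨v, B⟩ h
    simp only [Finset.mem_sigma, Finset.mem_powerset] at h ⊢
    exact ⟨Finset.insert_subset h.1 (h.2.trans (Finset.erase_subset _ _)),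
      Finset.mem_insert_self _ _⟩
  · rintro ⟨B, v⟩ h
    simp only [Finset.mem_sigma, Finset.mem_powerset] at h ⊢
    simp [Finset.insert_erase h.2]
  · rintro ⟨v, B⟩ h
    simp only [Finset.mem_sigma, Finset.mem_powerset] at h ⊢
    have : v ∉ B := fun hv => by simpa using h.2 hv
    simp [Finset.erase_insert this]
  · rintro ⟨B, v⟩ _
    rfl

/-- The bijection from a finite set to its image under an embedding. -/
noncomputable def equivMap (f : ι ↪ κ) (A : Finset ι) : ↥A ≃ ↥(A.map f) :=
  Equiv.ofBijective (fun i => ⟨f i, Finset.mem_map_of_mem f i.2⟩)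
    ⟨fun i j h => Subtype.ext (f.injective (congrArg Subtype.val h)), fun j => by
      obtain ⟨i, hi, h⟩ := Finset.mem_map.1 j.2
      exact ⟨⟨i, hi⟩, Subtype.ext h⟩⟩

/-- The permanent of the submatrix of `M` with rows `A` and columns `B`. -/
def subpermanent [DecidableEq ι] [DecidableEq κ] (M : ι → κ → R) (A : Finset ι) (B : Finset κ) :
    R :=
  ∑ σ : ↥A ≃ ↥B, ∏ i : ↥A, M i (σ i)

lemma sum_option_equiv_prod {α β : Type*} [Fintype α] [Fintype β] [DecidableEq α] [DecidableEq β]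
    (M : Option α → β → R) :
    ∑ σ : Option α ≃ β, ∏ o, M o (σ o) =
      ∑ b, M none b * ∑ τ : α ≃ {y // y ≠ b}, ∏ a, M (some a) (τ a) := by
  rw [← Finset.sum_fiberwise (s := Finset.univ) (g := fun σ : Option α ≃ β => σ none)]
  refine Finset.sum_congr rfl fun b _ => ?_
  rw [Finset.mul_sum, Finset.sum_subtype (p := fun σ : Option α ≃ β => σ none = b) _ (by simp)]
  refine Fintype.sum_equiv (Equiv.optionSubtype b) _ _ fun σ => ?_
  rw [Fintype.prod_option, σ.2]
  simp

variable [DecidableEq ι] [DecidableEq κ]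

lemma subpermanent_insert (M : ι → κ → R) {A : Finset ι} (B : Finset κ) {u : ι} (hu : u ∉ A) :
    subpermanent M (insert u A) B = ∑ v ∈ B, M u v * subpermanent M A (B.erase v) := by
  unfold subpermanent
  have h1 : ∑ σ : ↥(insert u A) ≃ ↥B, ∏ i : ↥(insert u A), M i (σ i) =
      ∑ σ : Option ↥A ≃ ↥B, ∏ o : Option ↥A, M (o.elim u (↑)) (σ o) := by
    refine Fintype.sum_equiv
      (Equiv.equivCongr (Finset.subtypeInsertEquivOption hu) (Equiv.refl _)) _ _ fun σ => ?_
    refine (Fintype.prod_equiv (Finset.subtypeInsertEquivOption hu).symm _ _ fun o => ?_).symm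
    cases o <;> simp [Finset.subtypeInsertEquivOption]
  rw [h1, sum_option_equiv_prod (fun (o : Option ↥A) (b : ↥B) => M (o.elim u (↑)) b),
    ← Finset.sum_coe_sort B]
  refine Finset.sum_congr rfl fun b _ => ?_
  simp only [Option.elim]
  congr 1
  refine Fintype.sum_equiv (Equiv.equivCongr (Equiv.refl _)
    { toFun := fun y => ⟨y.1.1, Finset.mem_erase.2 ⟨fun h => y.2 (Subtype.ext h), y.1.2⟩⟩
      invFun := fun y => ⟨⟨y.1, Finset.mem_of_mem_erase y.2⟩,
        fun h => Finset.ne_of_mem_erase y.2 (congrArg Subtype.val h)⟩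
      left_inv := fun _ => rfl
      right_inv := fun _ => rfl }) _ _ fun σ => ?_
  rfl

lemma subpermanent_eq_zero (M : ι → κ → R) {A : Finset ι} {B : Finset κ} (h : A.card ≠ B.card) :
    subpermanent M A B = 0 := by
  have : IsEmpty (↥A ≃ ↥B) := ⟨fun σ => h (by simpa using Fintype.card_congr σ)⟩
  simp [subpermanent]

lemma subpermanent_empty (M : ι → κ → R) : subpermanent M ∅ ∅ = 1 := by
  simp [subpermanent, Fintype.card_equiv (Equiv.equivOfIsEmpty ↥(∅ : Finset ι) ↥(∅ : Finset κ))]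

lemma subpermanent_map {ι' κ' : Type*} [DecidableEq ι'] [DecidableEq κ'] (f : ι ↪ ι')
    (g : κ ↪ κ') (M : ι' → κ' → R) (A : Finset ι) (B : Finset κ) :
    subpermanent M (A.map f) (B.map g) = subpermanent (fun i j => M (f i) (g j)) A B := by
  unfold subpermanent
  refine (Fintype.sum_equiv (Equiv.equivCongr (equivMap f A) (equivMap g B)) _ _ fun σ => ?_).symm
  refine Fintype.prod_equiv (equivMap f A) _ _ fun o => ?_
  rw [Equiv.equivCongr_apply_apply, Equiv.symm_apply_apply]
  rfl

lemma subpermanent_map_ringHom {R' : Type*} [CommRing R'] (φ : R →+* R') (M : ι → κ → R)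
    (A : Finset ι) (B : Finset κ) :
    subpermanent (fun i j => φ (M i j)) A B = φ (subpermanent M A B) := by
  simp [subpermanent, map_sum, map_prod]

lemma subpermanent_mul_left (c : R) (M : ι → κ → R) (A : Finset ι) (B : Finset κ) :
    subpermanent (fun i j => c * M i j) A B = c ^ A.card * subpermanent M A B := by
  simp [subpermanent, Finset.prod_mul_distrib, Finset.mul_sum]

end

section
variable {ι R : Type*} [CommRing R] [LinearOrder ι]

lemma matchingSum_union (V : ι → ι → R) (hV : ∀ i j, V i j = V j i) (P Q : Finset ι)
    (hPQ : Disjoint P Q) :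
    matchingSum V (P ∪ Q) = ∑ A ∈ P.powerset, ∑ B ∈ Q.powerset,
      subpermanent V A B * (matchingSum V (P \ A) * matchingSum V (Q \ B)) := by
  induction P using Finset.strongInduction generalizing Q with
  | H P ih =>
    obtain rfl | ⟨u, hu⟩ := P.eq_empty_or_nonempty
    · rw [Finset.powerset_empty, Finset.sum_singleton,
        Finset.sum_eq_single_of_mem ∅ (Finset.empty_mem_powerset Q)]
      · simp [subpermanent_empty]
      · intro B _ hB
        rw [subpermanent_eq_zero, zero_mul]
        simpa using fun h : 0 = B.card => hB (Finset.card_eq_zero.1 h.symm)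
    · obtain ⟨T, huT, rfl⟩ : ∃ T, u ∉ T ∧ P = insert u T :=
        ⟨P.erase u, Finset.notMem_erase _ _, (Finset.insert_erase hu).symm⟩
      obtain ⟨huQ, hTQ⟩ := Finset.disjoint_insert_left.1 hPQ
      have hssub : T ⊂ insert u T := Finset.ssubset_insert huT
      rw [Finset.insert_union, matchingSum_insert V hV (by simp [huT, huQ]),
        Finset.sum_union hTQ, Finset.sum_powerset_insert huT]
      congr 1
      · have h1 : ∀ v ∈ T, V u v * matchingSum V ((T ∪ Q).erase v) =
            ∑ A ∈ (T.erase v).powerset, V u v * ∑ B ∈ Q.powerset, subpermanent V A B *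
              (matchingSum V ((T \ A).erase v) * matchingSum V (Q \ B)) := by
          intro v hv
          have : (T ∪ Q).erase v = T.erase v ∪ Q := by
            rw [Finset.erase_union_distrib,
              Finset.erase_eq_of_notMem (Finset.disjoint_left.1 hTQ hv)]
          rw [this, ih _ ((Finset.erase_subset _ _).trans_ssubset hssub) Q
            (Finset.disjoint_of_subset_left (Finset.erase_subset _ _) hTQ), Finset.mul_sum]
          simp only [Finset.erase_sdiff_comm]
        rw [Finset.sum_congr rfl h1, Finset.sum_comm' (t' := T.powerset) (s' := fun A => T \ A)]
        · refine Finset.sum_congr rfl fun A hA => ?_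
          have huA : u ∉ A := fun h => huT (Finset.mem_powerset.1 hA h)
          rw [Finset.insert_sdiff_of_notMem _ huA,
            matchingSum_insert V hV (by simp [huT] : u ∉ T \ A)]
          simp only [Finset.mul_sum, Finset.sum_mul]
          rw [Finset.sum_comm]
          refine Finset.sum_congr rfl fun B _ => Finset.sum_congr rfl fun v _ => ?_
          ring
        · intro v A
          simp only [Finset.mem_powerset, Finset.subset_erase, Finset.mem_sdiff]
          tauto
      · have h1 : ∀ v ∈ Q, V u v * matchingSum V ((T ∪ Q).erase v) =
            ∑ A ∈ T.powerset, ∑ B ∈ (Q.erase v).powerset, V u v * (subpermanent V A B *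
              (matchingSum V (T \ A) * matchingSum V (Q.erase v \ B))) := by
          intro v hv
          have : (T ∪ Q).erase v = T ∪ Q.erase v := by
            rw [Finset.erase_union_distrib,
              Finset.erase_eq_of_notMem (Finset.disjoint_right.1 hTQ hv)]
          rw [this, ih _ hssub _
            (Finset.disjoint_of_subset_right (Finset.erase_subset _ _) hTQ), Finset.mul_sum]
          simp only [Finset.mul_sum]
        rw [Finset.sum_congr rfl h1, Finset.sum_comm]
        refine Finset.sum_congr rfl fun A hA => ?_
        have huA : u ∉ A := fun h => huT (Finset.mem_powerset.1 hA h)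
        rw [← sum_powerset_sum_mem Q fun v B => V u v * (subpermanent V A B *
              (matchingSum V (T \ A) * matchingSum V (Q.erase v \ B)))]
        refine Finset.sum_congr rfl fun B hB => ?_
        rw [subpermanent_insert V B huA, Finset.sum_mul]
        refine Finset.sum_congr rfl fun v hv => ?_
        have e1 : insert u T \ insert u A = T \ A := by
          ext i
          simp only [Finset.mem_sdiff, Finset.mem_insert]
          constructor
          · tauto
          · rintro ⟨h1, h2⟩
            exact ⟨Or.inr h1, fun h => h.elim (fun h => huT (h ▸ h1)) h2⟩
        have e2 : Q.erase v \ B.erase v = Q \ B := by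
          ext i
          simp only [Finset.mem_sdiff, Finset.mem_erase]
          by_cases h : i = v
          · simp [h, hv]
          · simp [h]
        rw [e1, e2, mul_assoc]

lemma sum_powersetCard_matchingSum_mul (V : ι → ι → R) (hV : ∀ i j, V i j = V j i)
    (S : Finset ι) (j : ℕ) :
    ∑ a ∈ Finset.powersetCard (2 * j) S, matchingSum V a * matchingSum V (S \ a) =
      ((S.card / 2).choose j : R) * matchingSum V S := by
  induction S using Finset.strongInduction generalizing j with
  | H S ih =>
    obtain rfl | ⟨u, hu⟩ := S.eq_empty_or_nonempty
    · cases j with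
      | zero => simp
      | succ j => rw [Finset.powersetCard_eq_empty.2 (by simp)]; simp
    · obtain ⟨T, huT, rfl⟩ : ∃ T, u ∉ T ∧ S = insert u T :=
        ⟨S.erase u, Finset.notMem_erase _ _, (Finset.insert_erase hu).symm⟩
      have hssub : ∀ v, T.erase v ⊂ insert u T := fun v =>
        (Finset.erase_subset _ _).trans_ssubset (Finset.ssubset_insert huT)
      have hnot : ∑ a ∈ Finset.powersetCard (2 * j) T,
          matchingSum V a * matchingSum V (insert u T \ a) =
            ∑ v ∈ T, V u v * ((((T.erase v).card / 2).choose j : R) *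
              matchingSum V (T.erase v)) := by
        have h1 : ∀ v ∈ T, V u v * ((((T.erase v).card / 2).choose j : R) *
            matchingSum V (T.erase v)) = ∑ a ∈ Finset.powersetCard (2 * j) (T.erase v),
              V u v * (matchingSum V a * matchingSum V ((T \ a).erase v)) := by
          intro v _
          rw [← ih _ (hssub v) j, Finset.mul_sum]
          simp only [Finset.erase_sdiff_comm]
        rw [Finset.sum_congr rfl h1,
          Finset.sum_comm' (t' := Finset.powersetCard (2 * j) T) (s' := fun a => T \ a)]
        · refine Finset.sum_congr rfl fun a ha => ?_
          have hua : u ∉ a := fun h => huT ((Finset.mem_powersetCard.1 ha).1 h)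
          rw [Finset.insert_sdiff_of_notMem _ hua,
            matchingSum_insert V hV (by simp [huT] : u ∉ T \ a), Finset.mul_sum]
          refine Finset.sum_congr rfl fun v _ => ?_
          ring
        · intro v a
          simp only [Finset.mem_powersetCard, Finset.subset_erase, Finset.mem_sdiff]
          tauto
      have hcard : ∀ v ∈ T, ((insert u T).card / 2) = (T.erase v).card / 2 + 1 := by
        intro v hv
        rw [Finset.card_insert_of_notMem huT, ← Finset.card_erase_add_one hv]
        omega
      rw [matchingSum_insert V hV huT, Finset.mul_sum]
      cases j with
      | zero =>
        simp only [mul_zero, Finset.powersetCard_zero, Finset.sum_singleton] at hnot ⊢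
        rw [hnot]
        simp
      | succ j =>
        have hcons : 2 * (j + 1) = (2 * j + 1).succ := by omega
        have hmem : ∑ a ∈ Finset.powersetCard (2 * j + 1) T,
            matchingSum V (insert u a) * matchingSum V (insert u T \ insert u a) =
              ∑ v ∈ T, V u v * ((((T.erase v).card / 2).choose j : R) *
                matchingSum V (T.erase v)) := by
          have h1 : ∀ v ∈ T, V u v * ((((T.erase v).card / 2).choose j : R) *
              matchingSum V (T.erase v)) = ∑ a ∈ (T.erase v).powerset,
                if a.card = 2 * j then
                  V u v * (matchingSum V a * matchingSum V (T.erase v \ a)) else 0 := by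
            intro v _
            rw [← ih _ (hssub v) j, Finset.mul_sum, Finset.powersetCard_eq_filter,
              Finset.sum_filter]
          rw [Finset.sum_congr rfl h1, ← sum_powerset_sum_mem T fun v a =>
            if a.card = 2 * j then
              V u v * (matchingSum V a * matchingSum V (T.erase v \ a)) else 0,
            Finset.powersetCard_eq_filter, Finset.sum_filter]
          refine Finset.sum_congr rfl fun a ha => ?_
          have hua : u ∉ a := fun h => huT (Finset.mem_powerset.1 ha h)
          split_ifs with hc
          · rw [matchingSum_insert V hV hua, Finset.sum_mul]
            refine Finset.sum_congr rfl fun v hv => ?_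
            have e1 : insert u T \ insert u a = T \ a := by
              ext i
              simp only [Finset.mem_sdiff, Finset.mem_insert]
              constructor
              · tauto
              · rintro ⟨h1, h2⟩
                exact ⟨Or.inr h1, fun h => h.elim (fun h => huT (h ▸ h1)) h2⟩
            have e2 : T.erase v \ a.erase v = T \ a := by
              ext i
              simp only [Finset.mem_sdiff, Finset.mem_erase]
              by_cases h : i = v
              · simp [h, hv]
              · simp [h]
            rw [e1, e2, if_pos, mul_assoc]
            rw [Finset.card_erase_of_mem hv]
            omega
          · refine (Finset.sum_eq_zero fun v hv => ?_).symm
            rw [if_neg]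
            have := Finset.card_erase_add_one hv
            omega
        rw [hcons, Finset.powersetCard_succ_insert huT, Finset.sum_union, Finset.sum_image,
          hmem, ← hcons, hnot, ← Finset.sum_add_distrib]
        · refine Finset.sum_congr rfl fun v hv => ?_
          rw [hcard v hv, Nat.choose_succ_succ]
          push_cast
          ring
        · intro a ha b hb hab
          have hua : u ∉ a := fun h => huT ((Finset.mem_powersetCard.1 ha).1 h)
          have hub : u ∉ b := fun h => huT ((Finset.mem_powersetCard.1 hb).1 h)
          rw [← Finset.erase_insert hua, hab, Finset.erase_insert hub]
        · rw [Finset.disjoint_left]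
          intro a ha hb
          obtain ⟨b, _, rfl⟩ := Finset.mem_image.1 hb
          exact huT ((Finset.mem_powersetCard.1 ha).1 (Finset.mem_insert_self _ _))

end

section
open Polynomial
variable {ι K : Type*} [LinearOrder ι] [CommRing K]

lemma sum_sum_erase_derivative (V : ι → ι → K[X]) (hV : ∀ i j, V i j = V j i) (S : Finset ι) :
    ∑ u ∈ S, ∑ v ∈ S.erase u, derivative (V u v) * matchingSum V ((S.erase u).erase v) =
      2 * derivative (matchingSum V S) := by
  induction S using Finset.strongInduction with
  | H S ih =>
    obtain rfl | ⟨u, hu⟩ := S.eq_empty_or_nonempty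
    · simp
    · obtain ⟨T, huT, rfl⟩ : ∃ T, u ∉ T ∧ S = insert u T :=
        ⟨S.erase u, Finset.notMem_erase _ _, (Finset.insert_erase hu).symm⟩
      have hssub : ∀ v, T.erase v ⊂ insert u T := fun v =>
        (Finset.erase_subset _ _).trans_ssubset (Finset.ssubset_insert huT)
      have hne : ∀ v ∈ T, v ≠ u := fun v hv h => huT (h ▸ hv)
      have h1 : ∀ w ∈ T, ∑ v ∈ (insert u T).erase w,
          derivative (V w v) * matchingSum V (((insert u T).erase w).erase v) =
          derivative (V u w) * matchingSum V (T.erase w) +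
            ∑ v ∈ T.erase w, ∑ t ∈ (T.erase w).erase v,
              derivative (V w v) * (V u t * matchingSum V (((T.erase w).erase v).erase t)) := by
        intro w hw
        have huw : u ∉ T.erase w := fun h => huT (Finset.mem_of_mem_erase h)
        rw [Finset.erase_insert_of_ne (hne w hw).symm, Finset.sum_insert huw,
          Finset.erase_insert huw, hV w u]
        congr 1
        refine Finset.sum_congr rfl fun v hv => ?_
        rw [Finset.erase_insert_of_ne (hne v (Finset.mem_of_mem_erase hv)).symm,
          matchingSum_insert V hV fun h => huw (Finset.mem_of_mem_erase h), Finset.mul_sum]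
      have h2 : ∀ t ∈ T, 2 * (V u t * derivative (matchingSum V (T.erase t))) =
          ∑ w ∈ T.erase t, ∑ v ∈ (T.erase t).erase w,
            derivative (V w v) * (V u t * matchingSum V (((T.erase w).erase v).erase t)) := by
        intro t _
        rw [mul_left_comm, ← ih _ (hssub t), Finset.mul_sum]
        refine Finset.sum_congr rfl fun w _ => ?_
        rw [Finset.mul_sum]
        refine Finset.sum_congr rfl fun v _ => ?_
        rw [mul_left_comm, Finset.erase_right_comm (a := t) (b := w),
          Finset.erase_right_comm (a := t) (b := v)]
      have h3 : ∑ t ∈ T, ∑ w ∈ T.erase t, ∑ v ∈ (T.erase t).erase w,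
            derivative (V w v) * (V u t * matchingSum V (((T.erase w).erase v).erase t)) =
          ∑ w ∈ T, ∑ v ∈ T.erase w, ∑ t ∈ (T.erase w).erase v,
            derivative (V w v) * (V u t * matchingSum V (((T.erase w).erase v).erase t)) := by
        rw [Finset.sum_comm' (t' := T) (s' := fun w => T.erase w)]
        · refine Finset.sum_congr rfl fun w _ => Finset.sum_comm' fun t v => ?_
          simp only [Finset.mem_erase]
          tauto
        · intro t w
          simp only [Finset.mem_erase]
          tauto
      rw [Finset.sum_insert huT, Finset.erase_insert huT, Finset.sum_congr rfl h1,
        Finset.sum_add_distrib, ← h3, ← Finset.sum_congr rfl h2, matchingSum_insert V hV huT]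
      simp only [derivative_sum, derivative_mul, Finset.sum_add_distrib, ← Finset.mul_sum]
      ring

/-- Summing over the common label `y` of two new vertices `u` and `v` turns the matching sum into
a first order differential operator applied to the old one. -/
lemma sum_matchingSum_insert_insert [IsDomain K] [CharZero K] {Y : Type*} [Fintype Y]
    (V : ι → ι → K[X]) (hV : ∀ i j, V i j = V j i) (V' : Y → ι → ι → K[X])
    (hV' : ∀ y i j, V' y i j = V' y j i) {S : Finset ι} {u v : ι} (huv : u ≠ v) (hu : u ∉ S)
    (hv : v ∉ S) (hVV' : ∀ y, ∀ i ∈ S, ∀ j ∈ S, V' y i j = V i j) (d : K[X])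
    (hd : ∑ y, V' y u v = d * X)
    (hpair : ∀ i ∈ S, ∀ j ∈ S, ∑ y, (V' y u i * V' y v j + V' y u j * V' y v i) =
      2 * X * V i j + (1 - X ^ 2) * derivative (V i j)) :
    ∑ y, matchingSum (V' y) (insert u (insert v S)) =
      (d + (S.card : K[X])) * X * matchingSum V S + (1 - X ^ 2) * derivative (matchingSum V S) := by
  have huv' : u ∉ insert v S := by simp [huv, hu]
  have hstep : ∀ y, matchingSum (V' y) (insert u (insert v S)) =
      V' y u v * matchingSum V S + ∑ i ∈ S, ∑ j ∈ S.erase i,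
        V' y u i * V' y v j * matchingSum V ((S.erase i).erase j) := by
    intro y
    rw [matchingSum_insert _ (hV' y) huv', Finset.sum_insert hv, Finset.erase_insert hv,
      matchingSum_congr (hVV' y)]
    congr 1
    refine Finset.sum_congr rfl fun i hi => ?_
    have hiv : v ≠ i := fun h => hv (h ▸ hi)
    rw [Finset.erase_insert_of_ne hiv,
      matchingSum_insert _ (hV' y) fun h => hv (Finset.mem_of_mem_erase h), Finset.mul_sum]
    refine Finset.sum_congr rfl fun j _ => ?_
    rw [mul_assoc, matchingSum_congr fun a ha b hb => hVV' y a
      (Finset.mem_of_mem_erase (Finset.mem_of_mem_erase ha)) b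
      (Finset.mem_of_mem_erase (Finset.mem_of_mem_erase hb))]
  have hswap : ∀ y, ∑ i ∈ S, ∑ j ∈ S.erase i,
        V' y u i * V' y v j * matchingSum V ((S.erase i).erase j) =
      ∑ i ∈ S, ∑ j ∈ S.erase i,
        V' y u j * V' y v i * matchingSum V ((S.erase i).erase j) := by
    intro y
    rw [Finset.sum_comm' (t' := S) (s' := fun i => S.erase i)]
    · simp only [Finset.erase_right_comm]
    · intro i j
      simp only [Finset.mem_erase]
      tauto
  have htwo : (2 : K[X]) * ∑ y, ∑ i ∈ S, ∑ j ∈ S.erase i,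
        V' y u i * V' y v j * matchingSum V ((S.erase i).erase j) =
      ∑ i ∈ S, ∑ j ∈ S.erase i, (2 * X * V i j + (1 - X ^ 2) * derivative (V i j)) *
        matchingSum V ((S.erase i).erase j) := by
    rw [two_mul]
    nth_rewrite 2 [Finset.sum_congr rfl fun y _ => hswap y]
    rw [← Finset.sum_add_distrib]
    simp only [← Finset.sum_add_distrib, ← add_mul]
    rw [Finset.sum_comm]
    refine Finset.sum_congr rfl fun i hi => ?_
    rw [Finset.sum_comm]
    refine Finset.sum_congr rfl fun j hj => ?_
    rw [← Finset.sum_mul, hpair i hi j (Finset.mem_of_mem_erase hj)]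
  have hsplit : ∑ i ∈ S, ∑ j ∈ S.erase i, (2 * X * V i j + (1 - X ^ 2) * derivative (V i j)) *
        matchingSum V ((S.erase i).erase j) =
      2 * X * ((S.card : K[X]) * matchingSum V S) +
        (1 - X ^ 2) * (2 * derivative (matchingSum V S)) := by
    rw [← sum_sum_erase_mul_matchingSum V hV, ← sum_sum_erase_derivative V hV]
    simp only [Finset.mul_sum, ← Finset.sum_add_distrib]
    refine Finset.sum_congr rfl fun i _ => Finset.sum_congr rfl fun j _ => ?_
    ring
  refine mul_left_cancel₀ (two_ne_zero : (2 : K[X]) ≠ 0) ?_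
  rw [Finset.sum_congr rfl fun y _ => hstep y, Finset.sum_add_distrib, ← Finset.sum_mul, hd,
    mul_add, htwo, hsplit]
  ring

end

section
open Polynomial

/-- The covariance matrix on `Fin m ⊕ Fin m` with diagonal blocks `W` and its complex conjugate,
and off-diagonal blocks `X • 1`. -/
noncomputable def blockWeight {m : ℕ} (W : Fin m → Fin m → ℂ) :
    Fin m ⊕ Fin m → Fin m ⊕ Fin m → ℂ[X]
  | .inl i, .inl j => C (W i j)
  | .inr i, .inr j => C (starRingEnd ℂ (W i j))
  | .inl i, .inr j => if i = j then X else 0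
  | .inr i, .inl j => if j = i then X else 0

variable {m : ℕ} {W : Fin m → Fin m → ℂ}

lemma blockWeight_comm (hW : ∀ i j, W i j = W j i) (a b : Fin m ⊕ Fin m) :
    blockWeight W a b = blockWeight W b a := by
  rcases a with a | a <;> rcases b with b | b <;> simp [blockWeight, hW a b]

lemma sum_blockWeight_mul (hW : ∀ i j, W i j = W j i)
    (hunit : ∀ i j, ∑ y, W y i * starRingEnd ℂ (W y j) = if i = j then 1 else 0)
    (a b : Fin m ⊕ Fin m) :
    ∑ y, (blockWeight W (.inl y) a * blockWeight W (.inr y) b +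
        blockWeight W (.inl y) b * blockWeight W (.inr y) a) =
      2 * X * blockWeight W a b + (1 - X ^ 2) * derivative (blockWeight W a b) := by
  have hunitC : ∀ i j, ∑ y, C (W y i) * C (starRingEnd ℂ (W y j)) =
      if i = j then (1 : ℂ[X]) else 0 := by
    intro i j
    simp only [← C_mul]
    rw [← map_sum, hunit]
    split_ifs <;> simp
  rw [Finset.sum_add_distrib]
  rcases a with a | a <;> rcases b with b | b <;> simp only [blockWeight]
  · simp [hW b a]
    ring
  · rw [hunitC]
    by_cases h : a = b
    · subst h
      simp
      ring
    · simp [h]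
  · rw [hunitC]
    by_cases h : a = b
    · subst h
      simp
      ring
    · simp [Ne.symm h]
  · simp [hW b a]
    ring

end

/-- The contribution of the `N` summed vertices to a configuration with `μ` mixed paths. -/
def marginalCoeff (N M μ : ℕ) : ℕ :=
  if μ % 2 = N % 2 ∧ μ ≤ N then N.factorial * (M - 1 + (N - μ) / 2).choose (M - 1) else 0

lemma marginalCoeff_eq_zero {N M μ : ℕ} (h : ¬(μ % 2 = N % 2 ∧ μ ≤ N)) :
    marginalCoeff N M μ = 0 := if_neg h

lemma marginalCoeff_of_eq {N M μ r : ℕ} (h : N = 2 * r + μ) :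
    marginalCoeff N (M + 1) μ = N.factorial * (M + r).choose M := by
  have h1 : M + 1 - 1 + (N - μ) / 2 = M + r := by omega
  rw [marginalCoeff, if_pos (by omega), h1, Nat.add_sub_cancel]

lemma marginalCoeff_succ (N M μ : ℕ) :
    (2 * ((M : ℂ) + 1) - μ) * marginalCoeff N (M + 2) (μ + 1) +
        μ * marginalCoeff N (M + 2) (μ - 1) =
      marginalCoeff (N + 1) (M + 1) μ := by
  by_cases h : μ % 2 = (N + 1) % 2 ∧ μ ≤ N + 1
  · obtain ⟨r, hr⟩ : ∃ r, N + 1 = 2 * r + μ := ⟨(N + 1 - μ) / 2, by omega⟩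
    rw [marginalCoeff_of_eq hr]
    cases r with
    | zero =>
      obtain rfl : μ = N + 1 := by omega
      rw [marginalCoeff_eq_zero (μ := N + 1 + 1) (by omega),
        marginalCoeff_of_eq (μ := N + 1 - 1) (r := 0) (by omega)]
      simp [Nat.factorial_succ]
    | succ q =>
      have hpascal : (M + (q + 1)).choose M * (q + 1) = (M + (q + 1)).choose (M + 1) * (M + 1) := by
        rw [Nat.choose_succ_right_eq]
        congr 1
        omega
      have hpascal' : ((M + (q + 1)).choose M : ℂ) * (q + 1) =
          (M + (q + 1)).choose (M + 1) * (M + 1) := by exact_mod_cast hpascal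
      have hN : (N : ℂ) + 1 = 2 * (q + 1) + μ := by exact_mod_cast hr
      rw [marginalCoeff_of_eq (μ := μ + 1) (r := q) (by omega), Nat.factorial_succ,
        show M + 1 + q = M + (q + 1) by ring]
      push_cast
      rw [hN]
      rcases Nat.eq_zero_or_pos μ with rfl | hμ
      · push_cast
        linear_combination (-2 * (N.factorial : ℂ)) * hpascal'
      · rw [marginalCoeff_of_eq (μ := μ - 1) (r := q + 1) (by omega),
          show M + 1 + (q + 1) = M + (q + 1) + 1 by ring, Nat.choose_succ_succ]
        push_cast
        linear_combination (-2 * (N.factorial : ℂ)) * hpascal'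
  · rw [marginalCoeff_eq_zero h, marginalCoeff_eq_zero (μ := μ + 1) (by omega)]
    rcases Nat.eq_zero_or_pos μ with rfl | hμ
    · simp
    · rw [marginalCoeff_eq_zero (by omega)]
      simp

section
open Polynomial

/-- The linear functional on generating polynomials with values `marginalCoeff N M` on powers. -/
noncomputable def marginalFunctional (N M : ℕ) : ℂ[X] →ₗ[ℂ] ℂ :=
  Polynomial.lsum fun μ => (marginalCoeff N M μ : ℂ) • LinearMap.id

lemma marginalFunctional_monomial (N M μ : ℕ) (a : ℂ) :
    marginalFunctional N M (monomial μ a) = marginalCoeff N M μ * a := by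
  simp [marginalFunctional, Polynomial.lsum_apply]

lemma marginalFunctional_succ (N M : ℕ) (p : ℂ[X]) :
    marginalFunctional N (M + 2)
        (C (2 * ((M : ℂ) + 1)) * X * p + (1 - X ^ 2) * derivative p) =
      marginalFunctional (N + 1) (M + 1) p := by
  induction p using Polynomial.induction_on' with
  | add p q hp hq =>
    have h : C (2 * ((M : ℂ) + 1)) * X * (p + q) + (1 - X ^ 2) * derivative (p + q) =
        (C (2 * ((M : ℂ) + 1)) * X * p + (1 - X ^ 2) * derivative p) +
          (C (2 * ((M : ℂ) + 1)) * X * q + (1 - X ^ 2) * derivative q) := by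
      rw [derivative_add]
      ring
    rw [h, map_add, hp, hq, map_add]
  | monomial μ a =>
    have h : C (2 * ((M : ℂ) + 1)) * X * monomial μ a + (1 - X ^ 2) * derivative (monomial μ a) =
        monomial (μ + 1) ((2 * ((M : ℂ) + 1) - μ) * a) + monomial (μ - 1) (a * μ) := by
      rw [derivative_monomial]
      simp only [← C_mul_X_pow_eq_monomial, map_sub, map_mul, sub_mul, one_mul]
      rcases μ with _ | μ
      · simp
        ring
      · simp only [Nat.add_sub_cancel]
        ring
    rw [h, map_add]
    simp only [marginalFunctional_monomial]
    rw [← marginalCoeff_succ]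
    ring

end

lemma sum_powerset_map {ι κ A : Type*} [AddCommMonoid A] [DecidableEq κ]
    (f : ι ↪ κ) (S : Finset ι) (φ : Finset κ → A) :
    ∑ B ∈ (S.map f).powerset, φ B = ∑ B ∈ S.powerset, φ (B.map f) := by
  rw [Finset.map_eq_image, Finset.powerset_image, Finset.sum_image]
  · simp only [Finset.map_eq_image]
  · intro a _ b _ h
    exact Finset.image_injective f.injective h

section
open Polynomial
variable {ι κ R : Type*} [LinearOrder ι] [LinearOrder κ] [CommRing R]

lemma matchingSum_map_union_map (f g : ι ↪ κ) (hfg : ∀ i j, f i ≠ g j) (V : κ → κ → R)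
    (hV : ∀ i j, V i j = V j i) (S : Finset ι) :
    matchingSum V (S.map f ∪ S.map g) = ∑ A ∈ S.powerset, ∑ B ∈ S.powerset,
      subpermanent (fun i j => V (f i) (g j)) A B *
        (matchingSum (fun i j => V (f i) (f j)) (S \ A) *
          matchingSum (fun i j => V (g i) (g j)) (S \ B)) := by
  rw [matchingSum_union V hV, sum_powerset_map]
  · refine Finset.sum_congr rfl fun A _ => ?_
    rw [sum_powerset_map]
    refine Finset.sum_congr rfl fun B _ => ?_
    rw [subpermanent_map, ← Finset.map_sdiff, ← Finset.map_sdiff, matchingSum_map f V hV,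
      matchingSum_map g V hV]
  · rw [Finset.disjoint_left]
    intro a ha hb
    obtain ⟨i, _, rfl⟩ := Finset.mem_map.1 ha
    obtain ⟨j, _, h⟩ := Finset.mem_map.1 hb
    exact hfg i j h.symm

variable {m : ℕ}

/-- The generating polynomial, in the number of mixed edges, of the pairs of matchings on two
copies `S.map f` and `S.map g` of a vertex set `S`. The vertices of `S` are labelled by `z`, and
`side` tells which copy of which vertex is meant. -/
noncomputable def blockMatchingSum (f g : ι ↪ κ) (side : κ → ι ⊕ ι) (W : Fin m → Fin m → ℂ)
    (z : ι → Fin m) (S : Finset ι) : ℂ[X] :=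
  matchingSum (fun a b => blockWeight W (Sum.map z z (side a)) (Sum.map z z (side b)))
    (S.map f ∪ S.map g)

variable {f g : ι ↪ κ} {side : κ → ι ⊕ ι} {W : Fin m → Fin m → ℂ}

lemma marginalFunctional_blockMatchingSum (hf : ∀ i, side (f i) = .inl i)
    (hg : ∀ i, side (g i) = .inr i) (hW : ∀ i j, W i j = W j i) (N M : ℕ) (z : ι → Fin m)
    (S : Finset ι) :
    marginalFunctional N M (blockMatchingSum f g side W z S) =
      ∑ A ∈ S.powerset, ∑ B ∈ S.powerset, marginalCoeff N M A.card *
        (subpermanent (fun i j => if z i = z j then (1 : ℂ) else 0) A B *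
          (matchingSum (fun i j => W (z i) (z j)) (S \ A) *
            matchingSum (fun i j => starRingEnd ℂ (W (z i) (z j))) (S \ B))) := by
  have hfg : ∀ i j, f i ≠ g j := fun i j h => by
    have := hf i
    rw [h, hg] at this
    cases this
  unfold blockMatchingSum
  rw [matchingSum_map_union_map _ _ hfg _ fun a b => blockWeight_comm hW _ _]
  simp only [map_sum]
  refine Finset.sum_congr rfl fun A _ => Finset.sum_congr rfl fun B _ => ?_
  have h1 : subpermanent (fun i j : ι => if z i = z j then (X : ℂ[X]) else 0) A B =
      X ^ A.card * C (subpermanent (fun i j => if z i = z j then (1 : ℂ) else 0) A B) := by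
    rw [← subpermanent_map_ringHom, ← subpermanent_mul_left]
    congr 1
    ext1 i
    ext1 j
    split_ifs <;> simp
  rw [← marginalFunctional_monomial, ← C_mul_X_pow_eq_monomial]
  congr 1
  simp only [hf, hg, Sum.map_inl, Sum.map_inr, blockWeight]
  rw [h1, matchingSum_map_ringHom C, matchingSum_map_ringHom C]
  simp only [map_mul]
  ring

lemma marginalFunctional_zero_blockMatchingSum (hf : ∀ i, side (f i) = .inl i)
    (hg : ∀ i, side (g i) = .inr i) (hW : ∀ i j, W i j = W j i) (M : ℕ)
    (z : ι → Fin m) (S : Finset ι) :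
    marginalFunctional 0 M (blockMatchingSum f g side W z S) =
      matchingSum (fun i j => W (z i) (z j)) S *
        matchingSum (fun i j => starRingEnd ℂ (W (z i) (z j))) S := by
  rw [marginalFunctional_blockMatchingSum hf hg hW,
    Finset.sum_eq_single_of_mem ∅ (Finset.empty_mem_powerset S),
    Finset.sum_eq_single_of_mem ∅ (Finset.empty_mem_powerset S)]
  · simp [marginalCoeff, subpermanent_empty]
  · intro B _ hB
    rw [subpermanent_eq_zero, zero_mul, mul_zero]
    simpa using fun h : 0 = B.card => hB (Finset.card_eq_zero.1 h.symm)
  · intro A _ hA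
    refine Finset.sum_eq_zero fun B _ => ?_
    have : A.card ≠ 0 := fun h => hA (Finset.card_eq_zero.1 h)
    simp [marginalCoeff, this]

lemma sum_blockMatchingSum_insert (hf : ∀ i, side (f i) = .inl i)
    (hg : ∀ i, side (g i) = .inr i) (hW : ∀ i j, W i j = W j i)
    (hunit : ∀ i j, ∑ y, W y i * starRingEnd ℂ (W y j) = if i = j then 1 else 0)
    (z : ι → Fin m) {S : Finset ι} {k : ι} (hk : k ∉ S) :
    ∑ y, blockMatchingSum f g side W (Function.update z k y) (insert k S) =
      C ((m : ℂ) + 2 * (S.card : ℂ)) * X * blockMatchingSum f g side W z S +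
        (1 - X ^ 2) * derivative (blockMatchingSum f g side W z S) := by
  have hfg : ∀ i j, f i ≠ g j := fun i j h => by
    have := hf i
    rw [h, hg] at this
    cases this
  have hz : ∀ y, ∀ a ∈ S.map f ∪ S.map g,
      Sum.map (Function.update z k y) (Function.update z k y) (side a) =
        Sum.map z z (side a) := by
    intro y a ha
    rcases Finset.mem_union.1 ha with ha | ha <;> obtain ⟨i, hi, rfl⟩ := Finset.mem_map.1 ha <;>
      simp [hf, hg, Function.update_of_ne (fun h : i = k => hk (h ▸ hi))]
  have hcard : (S.map f ∪ S.map g).card = 2 * S.card := by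
    rw [Finset.card_union_of_disjoint, Finset.card_map, Finset.card_map, two_mul]
    rw [Finset.disjoint_left]
    intro a ha hb
    obtain ⟨i, _, rfl⟩ := Finset.mem_map.1 ha
    obtain ⟨j, _, h⟩ := Finset.mem_map.1 hb
    exact hfg i j h.symm
  simp only [blockMatchingSum, Finset.map_insert, Finset.insert_union, Finset.union_insert,
    Finset.insert_comm (g k) (f k)]
  rw [sum_matchingSum_insert_insert
    (fun a b => blockWeight W (Sum.map z z (side a)) (Sum.map z z (side b)))
    (fun a b => blockWeight_comm hW _ _)
    (fun y a b => blockWeight W (Sum.map (Function.update z k y) (Function.update z k y) (side a))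
      (Sum.map (Function.update z k y) (Function.update z k y) (side b)))
    (fun y a b => blockWeight_comm hW _ _) (hfg k k)
    (by simp [hk, (hfg _ _).symm]) (by simp [hk, hfg])
    (fun y a ha b hb => by rw [hz y a ha, hz y b hb]) (m : ℂ[X])]
  · rw [hcard]
    simp [← C_ofNat]
  · simp [hf, hg, blockWeight]
  · intro a ha b hb
    rw [← sum_blockWeight_mul hW hunit]
    refine Finset.sum_congr rfl fun y _ => ?_
    rw [hz y a ha, hz y b hb]
    simp [hf, hg]

end

section

/-- The labelling that agrees with `z` except on `k, …, k + N - 1`, where it is given by `y`. -/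
def extendLabels {α : Type*} {N : ℕ} (z : ℕ → α) (k : ℕ) (y : Fin N → α) (i : ℕ) : α :=
  if h : k ≤ i ∧ i < k + N then y ⟨i - k, by omega⟩ else z i

lemma extendLabels_cons {α : Type*} {N : ℕ} (z : ℕ → α) (k : ℕ) (a : α) (y : Fin N → α) :
    extendLabels z k (Fin.cons a y : Fin (N + 1) → α) =
      extendLabels (Function.update z k a) (k + 1) y := by
  ext1 i
  unfold extendLabels
  rcases lt_trichotomy i k with h | rfl | h
  · rw [dif_neg (by omega), dif_neg (by omega), Function.update_of_ne h.ne]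
  · rw [dif_pos (by omega), dif_neg (by omega), Function.update_self]
    simp
  · by_cases h' : i < k + (N + 1)
    · rw [dif_pos (by omega), dif_pos (by omega)]
      have : (⟨i - k, by omega⟩ : Fin (N + 1)) = Fin.succ ⟨i - (k + 1), by omega⟩ := by
        ext
        simp
        omega
      rw [this, Fin.cons_succ]
    · rw [dif_neg (by omega), dif_neg (by omega), Function.update_of_ne h.ne']

lemma sum_matchingSum_extendLabels {m p : ℕ} (hp : m = 2 * (p + 1)) {W : Fin m → Fin m → ℂ}
    (hW : ∀ i j, W i j = W j i)
    (hunit : ∀ i j, ∑ y, W y i * starRingEnd ℂ (W y j) = if i = j then 1 else 0)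
    {κ : Type*} [LinearOrder κ] {f g : ℕ ↪ κ} {side : κ → ℕ ⊕ ℕ}
    (hf : ∀ i, side (f i) = .inl i) (hg : ∀ i, side (g i) = .inr i) (N k : ℕ) (z : ℕ → Fin m) :
    ∑ y : Fin N → Fin m,
      matchingSum (fun i j => W (extendLabels z k y i) (extendLabels z k y j))
          (Finset.range (k + N)) *
        matchingSum
          (fun i j => starRingEnd ℂ (W (extendLabels z k y i) (extendLabels z k y j)))
          (Finset.range (k + N)) =
      marginalFunctional N (p + k + 1) (blockMatchingSum f g side W z (Finset.range k)) := by
  induction N generalizing k z with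
  | zero =>
    rw [marginalFunctional_zero_blockMatchingSum hf hg hW]
    have : ∀ y : Fin 0 → Fin m, extendLabels z k y = z := by
      intro y
      ext1 i
      exact dif_neg (by omega)
    simp [this]
  | succ N ih =>
    rw [← (Fin.consEquiv fun _ => Fin m).sum_comp, Fintype.sum_prod_type]
    have hk : k + (N + 1) = k + 1 + N := by omega
    have hcons : ∀ a (y : Fin N → Fin m),
        extendLabels z k ((Fin.consEquiv fun _ => Fin m) (a, y)) =
          extendLabels (Function.update z k a) (k + 1) y := fun a y => extendLabels_cons z k a y
    simp only [hcons, hk, ih]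
    rw [← map_sum, Finset.range_add_one,
      sum_blockMatchingSum_insert hf hg hW hunit z Finset.notMem_range_self, Finset.card_range,
      ← add_assoc p k 1, ← marginalFunctional_succ]
    congr 4
    rw [hp]
    push_cast
    congr 1
    ring

lemma sum_matchingSum_extendLabels_eq_sum_powerset {m p : ℕ} (hp : m = 2 * (p + 1))
    {W : Fin m → Fin m → ℂ} (hW : ∀ i j, W i j = W j i)
    (hunit : ∀ i j, ∑ y, W y i * starRingEnd ℂ (W y j) = if i = j then 1 else 0)
    (N k : ℕ) (z : ℕ → Fin m) :
    ∑ y : Fin N → Fin m,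
      matchingSum (fun i j => W (extendLabels z k y i) (extendLabels z k y j))
          (Finset.range (k + N)) *
        matchingSum
          (fun i j => starRingEnd ℂ (W (extendLabels z k y i) (extendLabels z k y j)))
          (Finset.range (k + N)) =
      ∑ A ∈ (Finset.range k).powerset, ∑ B ∈ (Finset.range k).powerset,
        marginalCoeff N (p + k + 1) A.card *
          (subpermanent (fun i j => if z i = z j then (1 : ℂ) else 0) A B *
            (matchingSum (fun i j => W (z i) (z j)) (Finset.range k \ A) *
              matchingSum (fun i j => starRingEnd ℂ (W (z i) (z j))) (Finset.range k \ B))) := by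
  have hf : ∀ i : ℕ, ofLex ((Function.Embedding.inl.trans toLex.toEmbedding :
      ℕ ↪ ℕ ⊕ₗ ℕ) i) = Sum.inl i := fun _ => rfl
  have hg : ∀ i : ℕ, ofLex ((Function.Embedding.inr.trans toLex.toEmbedding :
      ℕ ↪ ℕ ⊕ₗ ℕ) i) = Sum.inr i := fun _ => rfl
  rw [sum_matchingSum_extendLabels hp hW hunit hf hg,
    marginalFunctional_blockMatchingSum hf hg hW]

end

section

lemma sum_choose_mul_choose_sub {s T L : ℕ} (h : s ≤ L) :
    ∑ j ∈ Finset.range (s + 1), s.choose j * T.choose (L - j) = (T + s).choose L := by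
  rw [add_comm T s, Nat.add_choose_eq, Finset.Nat.sum_antidiagonal_eq_sum_range_succ_mk]
  refine Finset.sum_subset (Finset.range_mono (by omega)) fun j _ hj => ?_
  rw [Finset.mem_range] at hj
  rw [Nat.choose_eq_zero_of_lt (by omega), zero_mul]

lemma sum_sum_choose_mul_choose {k n p μ : ℕ} (hkn : k ≤ n) (hne : Even n) (hμk : μ ≤ k)
    (hμ : μ % 2 = k % 2) :
    ∑ j1 ∈ Finset.Icc (k - n / 2) (k / 2), ∑ j2 ∈ Finset.Icc (k - n / 2) (k / 2),
      ((n - k + μ + 2 * (p + 1)) / 2 - 1).choose (k - j1 - j2 + p) *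
        (((k - μ) / 2).choose j1 * ((k - μ) / 2).choose j2) =
      ((n - k + μ + 2 * (p + 1)) / 2 - 1 + 2 * ((k - μ) / 2)).choose (k + p) := by
  obtain ⟨h, rfl⟩ := hne
  obtain ⟨s, rfl⟩ : ∃ s, k = 2 * s + μ := ⟨(k - μ) / 2, by omega⟩
  have hs : (2 * s + μ - μ) / 2 = s := by omega
  obtain ⟨T, hT⟩ : ∃ T, (h + h - (2 * s + μ) + μ + 2 * (p + 1)) / 2 - 1 = T := ⟨_, rfl⟩
  have hT' : T + s = h + p := by omega
  rw [hs, hT, show (h + h) / 2 = h by omega]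
  have hIcc : ∀ φ : ℕ → ℕ, (∀ j, s < j → φ j = 0) → (∀ j ≤ s, j < 2 * s + μ - h → φ j = 0) →
      ∑ j ∈ Finset.Icc (2 * s + μ - h) ((2 * s + μ) / 2), φ j =
        ∑ j ∈ Finset.range (s + 1), φ j := by
    intro φ h1 h2
    have hlow : ∑ j ∈ Finset.Icc (2 * s + μ - h) ((2 * s + μ) / 2), φ j =
        ∑ j ∈ Finset.range ((2 * s + μ) / 2 + 1), φ j := by
      refine Finset.sum_subset (fun j hj => ?_) fun j hj hj' => ?_
      · rw [Finset.mem_Icc] at hj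
        rw [Finset.mem_range]
        omega
      · rw [Finset.mem_range] at hj
        rw [Finset.mem_Icc] at hj'
        rcases lt_or_ge s j with hsj | hsj
        · exact h1 j hsj
        · exact h2 j hsj (by omega)
    have hhigh : ∑ j ∈ Finset.range (s + 1), φ j =
        ∑ j ∈ Finset.range ((2 * s + μ) / 2 + 1), φ j :=
      Finset.sum_subset (Finset.range_mono (by omega)) fun j _ hj => h1 j (by simpa using hj)
    rw [hlow, hhigh]
  have hzero : ∀ j1 ≤ s, ∀ j2 ≤ s, j1 < 2 * s + μ - h ∨ j2 < 2 * s + μ - h →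
      T.choose (2 * s + μ - j1 - j2 + p) = 0 := fun j1 h1 j2 h2 h3 =>
    Nat.choose_eq_zero_of_lt (by omega)
  rw [hIcc]
  · calc _ = ∑ j1 ∈ Finset.range (s + 1), s.choose j1 * ∑ j2 ∈ Finset.range (s + 1),
          s.choose j2 * T.choose (2 * s + μ + p - j1 - j2) := by
          refine Finset.sum_congr rfl fun j1 hj1 => ?_
          rw [Finset.mem_range, Nat.lt_succ_iff] at hj1
          rw [hIcc, Finset.mul_sum]
          · refine Finset.sum_congr rfl fun j2 hj2 => ?_
            rw [Finset.mem_range, Nat.lt_succ_iff] at hj2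
            rw [show 2 * s + μ + p - j1 - j2 = 2 * s + μ - j1 - j2 + p by omega]
            ring
          · intro j hj
            rw [Nat.choose_eq_zero_of_lt hj, mul_zero, mul_zero]
          · intro j hj hj'
            rw [hzero j1 hj1 j hj (Or.inr hj'), zero_mul]
      _ = ∑ j1 ∈ Finset.range (s + 1), s.choose j1 * (T + s).choose (2 * s + μ + p - j1) := by
          refine Finset.sum_congr rfl fun j1 hj1 => ?_
          rw [Finset.mem_range, Nat.lt_succ_iff] at hj1
          rw [sum_choose_mul_choose_sub (by omega)]
      _ = _ := by
          rw [sum_choose_mul_choose_sub (by omega), two_mul, add_assoc T]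
  · intro j hj
    simp [Nat.choose_eq_zero_of_lt hj]
  · intro j hj hj'
    refine Finset.sum_eq_zero fun j2 _ => ?_
    rcases lt_or_ge s j2 with h2 | h2
    · rw [Nat.choose_eq_zero_of_lt h2, mul_zero, mul_zero]
    · rw [hzero j hj j2 h2 (Or.inl hj'), zero_mul]

lemma marginalCoeff_eq {k n p μ : ℕ} (hkn : k ≤ n) (hne : Even n) (hμk : μ ≤ k)
    (hμ : μ % 2 = k % 2) :
    marginalCoeff (n - k) (p + k + 1) μ = (n - k).factorial *
      ((n - k + μ + 2 * (p + 1)) / 2 - 1 + 2 * ((k - μ) / 2)).choose (k + p) := by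
  obtain ⟨h, rfl⟩ := hne
  unfold marginalCoeff
  split_ifs with hc
  · congr 2 <;> omega
  · rw [Nat.choose_eq_zero_of_lt, mul_zero]
    omega

end

section
variable {ι R : Type*} [LinearOrder ι] [CommRing R]

lemma sum_powersetCard_sdiff_comm (i j : ℕ) (S : Finset ι) (φ : Finset ι → Finset ι → R) :
    ∑ a ∈ Finset.powersetCard i S, ∑ A ∈ Finset.powersetCard j (S \ a), φ a A =
      ∑ A ∈ Finset.powersetCard j S, ∑ a ∈ Finset.powersetCard i (S \ A), φ a A := by
  refine Finset.sum_comm' fun a A => ?_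
  simp only [Finset.mem_powersetCard, Finset.subset_sdiff, disjoint_comm (a := a)]
  tauto

lemma sum_powersetCard_matchingSum_mul_matchingSum (V : ι → ι → R) (hV : ∀ i j, V i j = V j i)
    (S : Finset ι) (j μ : ℕ) (ψ : Finset ι → R) :
    ∑ a ∈ Finset.powersetCard (2 * j) S, ∑ A ∈ Finset.powersetCard μ (S \ a),
        matchingSum V a * matchingSum V (S \ (a ∪ A)) * ψ A =
      (((S.card - μ) / 2).choose j : R) *
        ∑ A ∈ Finset.powersetCard μ S, matchingSum V (S \ A) * ψ A := by
  rw [sum_powersetCard_sdiff_comm, Finset.mul_sum]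
  refine Finset.sum_congr rfl fun A hA => ?_
  obtain ⟨hAS, rfl⟩ := Finset.mem_powersetCard.1 hA
  have hsdiff : ∀ a, S \ (a ∪ A) = (S \ A) \ a := fun a => by
    ext i
    simp only [Finset.mem_sdiff, Finset.mem_union]
    tauto
  simp only [hsdiff]
  rw [← Finset.sum_mul, sum_powersetCard_matchingSum_mul V hV, Finset.card_sdiff_of_subset hAS,
    mul_assoc]

lemma sum_sum_matchingSum_mul_sum_sum (V V' : ι → ι → R) (hV : ∀ i j, V i j = V j i)
    (hV' : ∀ i j, V' i j = V' j i) (P : Finset ι → Finset ι → R) (S : Finset ι) (j1 j2 μ : ℕ) :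
    ∑ a ∈ Finset.powersetCard (2 * j1) S, ∑ a' ∈ Finset.powersetCard (2 * j2) S,
        matchingSum V a * matchingSum V' a' *
          ∑ A ∈ Finset.powersetCard μ (S \ a), ∑ B ∈ Finset.powersetCard μ (S \ a'),
            P A B * matchingSum V (S \ (a ∪ A)) * matchingSum V' (S \ (a' ∪ B)) =
      (((S.card - μ) / 2).choose j1 : R) * (((S.card - μ) / 2).choose j2 : R) *
        ∑ A ∈ Finset.powersetCard μ S, ∑ B ∈ Finset.powersetCard μ S,
          P A B * (matchingSum V (S \ A) * matchingSum V' (S \ B)) := by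
  have h1 : ∀ a ∈ Finset.powersetCard (2 * j1) S, ∑ a' ∈ Finset.powersetCard (2 * j2) S,
        matchingSum V a * matchingSum V' a' *
          ∑ A ∈ Finset.powersetCard μ (S \ a), ∑ B ∈ Finset.powersetCard μ (S \ a'),
            P A B * matchingSum V (S \ (a ∪ A)) * matchingSum V' (S \ (a' ∪ B)) =
      ∑ A ∈ Finset.powersetCard μ (S \ a), matchingSum V a * matchingSum V (S \ (a ∪ A)) *
        ∑ a' ∈ Finset.powersetCard (2 * j2) S, ∑ B ∈ Finset.powersetCard μ (S \ a'),
          matchingSum V' a' * matchingSum V' (S \ (a' ∪ B)) * P A B := by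
    intro a _
    simp only [Finset.mul_sum]
    rw [Finset.sum_comm]
    refine Finset.sum_congr rfl fun A _ => Finset.sum_congr rfl fun a' _ =>
      Finset.sum_congr rfl fun B _ => ?_
    ring
  rw [Finset.sum_congr rfl h1, sum_powersetCard_matchingSum_mul_matchingSum V hV, mul_assoc]
  congr 1
  simp only [sum_powersetCard_matchingSum_mul_matchingSum V' hV', Finset.mul_sum]
  refine Finset.sum_congr rfl fun A _ => Finset.sum_congr rfl fun B _ => ?_
  ring

end

section

lemma sum_powerset_sum_powerset_subpermanent {ι R : Type*} [DecidableEq ι] [CommRing R]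
    (S : Finset ι) (M : ι → ι → R) (c : ℕ → R) (φ : Finset ι → Finset ι → R) :
    ∑ A ∈ S.powerset, ∑ B ∈ S.powerset, c A.card * (subpermanent M A B * φ A B) =
      ∑ μ ∈ Finset.range (S.card + 1), c μ *
        ∑ A ∈ Finset.powersetCard μ S, ∑ B ∈ Finset.powersetCard μ S,
          subpermanent M A B * φ A B := by
  rw [Finset.sum_powerset]
  refine Finset.sum_congr rfl fun μ _ => ?_
  rw [Finset.mul_sum]
  refine Finset.sum_congr rfl fun A hA => ?_
  obtain ⟨_, rfl⟩ := Finset.mem_powersetCard.1 hA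
  rw [Finset.mul_sum]
  refine (Finset.sum_subset (fun B hB => ?_) fun B hB hB' => ?_).symm
  · exact Finset.mem_powerset.2 (Finset.mem_powersetCard.1 hB).1
  · rw [subpermanent_eq_zero, zero_mul, mul_zero]
    exact fun h => hB' (Finset.mem_powersetCard.2 ⟨Finset.mem_powerset.1 hB, h.symm⟩)

lemma sum_sum_sum_choose_mul {k n p : ℕ} (hkn : k ≤ n) (hne : Even n) (D : ℂ) (G : ℕ → ℂ) :
    ∑ j1 ∈ Finset.Icc (k - n / 2) (k / 2), ∑ j2 ∈ Finset.Icc (k - n / 2) (k / 2),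
      ∑ μ ∈ (Finset.Icc (3 * k - 2 * (j1 + j2) - n) (k - 2 * max j1 j2)).filter
          (fun μ => μ % 2 = k % 2),
        ((n - k).factorial : ℂ) / D *
          (((n - k + μ + 2 * (p + 1)) / 2 - 1).choose (k - j1 - j2 + 2 * (p + 1) / 2 - 1) : ℂ) *
          ((((k - μ) / 2).choose j1 : ℂ) * (((k - μ) / 2).choose j2 : ℂ) * G μ) =
      (∑ μ ∈ Finset.range (k + 1), (marginalCoeff (n - k) (p + k + 1) μ : ℂ) * G μ) / D := by
  have hp : ∀ a, a + 2 * (p + 1) / 2 - 1 = a + p := by omega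
  simp only [hp]
  have hrange : ∀ j1 ∈ Finset.Icc (k - n / 2) (k / 2), ∀ j2 ∈ Finset.Icc (k - n / 2) (k / 2),
      ∑ μ ∈ (Finset.Icc (3 * k - 2 * (j1 + j2) - n) (k - 2 * max j1 j2)).filter
          (fun μ => μ % 2 = k % 2),
        ((n - k).factorial : ℂ) / D *
          (((n - k + μ + 2 * (p + 1)) / 2 - 1).choose (k - j1 - j2 + p) : ℂ) *
          ((((k - μ) / 2).choose j1 : ℂ) * (((k - μ) / 2).choose j2 : ℂ) * G μ) =
      ∑ μ ∈ (Finset.range (k + 1)).filter (fun μ => μ % 2 = k % 2),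
        ((n - k).factorial : ℂ) / D * G μ *
          ((((n - k + μ + 2 * (p + 1)) / 2 - 1).choose (k - j1 - j2 + p) *
            (((k - μ) / 2).choose j1 * ((k - μ) / 2).choose j2) : ℕ) : ℂ) := by
    intro j1 hj1 j2 hj2
    rw [Finset.mem_Icc] at hj1 hj2
    refine (Finset.sum_subset (fun μ hμ => ?_) fun μ hμ hμ' => ?_).trans
      (Finset.sum_congr rfl fun μ _ => ?_)
    · simp only [Finset.mem_filter, Finset.mem_Icc, Finset.mem_range] at hμ ⊢
      omega
    · simp only [Finset.mem_filter, Finset.mem_Icc, Finset.mem_range, not_and_or] at hμ hμ'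
      obtain ⟨h, hh⟩ := hne
      have hcases : (n - k + μ + 2 * (p + 1)) / 2 - 1 < k - j1 - j2 + p ∨
          (k - μ) / 2 < j1 ∨ (k - μ) / 2 < j2 := by omega
      rcases hcases with hlt | hlt | hlt <;> simp [Nat.choose_eq_zero_of_lt hlt]
    · push_cast
      ring
  rw [Finset.sum_congr rfl fun j1 hj1 => Finset.sum_congr rfl fun j2 hj2 => hrange j1 hj1 j2 hj2]
  rw [Finset.sum_congr rfl fun j1 _ => Finset.sum_comm, Finset.sum_comm, Finset.sum_div,
    Finset.sum_filter]
  refine Finset.sum_congr rfl fun μ hμ => ?_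
  split_ifs with hpar
  · simp only [← Finset.mul_sum]
    rw [Finset.mem_range, Nat.lt_succ_iff] at hμ
    have := sum_sum_choose_mul_choose (p := p) hkn hne hμ hpar
    rw [marginalCoeff_eq hkn hne hμ hpar, ← this]
    push_cast
    ring
  · rw [marginalCoeff_eq_zero]
    · simp
    · obtain ⟨h, rfl⟩ := hne
      omega

lemma sum_normSq_hafnian {k N p m : ℕ} (hm : m = 2 * (p + 1)) {W : Fin m → Fin m → ℂ}
    (hW : ∀ i j, W i j = W j i)
    (hunit : ∀ i j, ∑ y, W y i * starRingEnd ℂ (W y j) = if i = j then 1 else 0)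
    (x : Fin k → Fin m) {n : ℕ} (hn : n = k + N) :
    ∑ y : Fin N → Fin m, (Complex.normSq (hafnian (fun i j : Fin n =>
        W (Fin.append x y (Fin.cast hn i)) (Fin.append x y (Fin.cast hn j)))) : ℂ) =
      ∑ μ ∈ Finset.range (k + 1), (marginalCoeff N (p + k + 1) μ : ℂ) *
        ∑ A ∈ Finset.powersetCard μ Finset.univ, ∑ B ∈ Finset.powersetCard μ Finset.univ,
          subpermanent (fun i j => if x i = x j then (1 : ℂ) else 0) A B *
            (matchingSum (fun i j => W (x i) (x j)) (Finset.univ \ A) *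
              matchingSum (fun i j => starRingEnd ℂ (W (x i) (x j))) (Finset.univ \ B)) := by
  subst hn
  obtain ⟨z, hz⟩ : ∃ z : ℕ → Fin m, ∀ i : Fin k, z i = x i :=
    ⟨fun i => if h : i < k then x ⟨i, h⟩ else ⟨0, by omega⟩, fun i => by simp⟩
  have hrange : ∀ j, Finset.range j = Finset.univ.map (Fin.valEmbedding (n := j)) := fun j => by
    ext i
    simp
  have happ : ∀ (y : Fin N → Fin m) (i : Fin (k + N)),
      Fin.append x y i = extendLabels z k y i := by
    intro y i
    refine Fin.addCases (fun i => ?_) (fun i => ?_) i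
    · rw [Fin.append_left, extendLabels, dif_neg (by simp), Fin.val_castAdd, hz]
    · rw [Fin.append_right, extendLabels, dif_pos (by simp)]
      simp
  have hconj : ∀ i j, starRingEnd ℂ (W i j) = starRingEnd ℂ (W j i) := fun i j => by rw [hW]
  have key := sum_matchingSum_extendLabels_eq_sum_powerset hm hW hunit N k z
  rw [hrange k, sum_powerset_map] at key
  simp only [sum_powerset_map, ← Finset.map_sdiff, Finset.card_map, subpermanent_map] at key
  rw [hrange (k + N)] at key
  have hmap : ∀ (j : ℕ) (w : ℕ → Fin m) (S : Finset (Fin j)),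
      matchingSum (fun a b => W (w a) (w b)) (S.map Fin.valEmbedding) =
        matchingSum (fun a b : Fin j => W (w a) (w b)) S := fun j w S =>
    matchingSum_map Fin.valEmbedding _ (fun a b => hW _ _) S
  have hmap' : ∀ (j : ℕ) (w : ℕ → Fin m) (S : Finset (Fin j)),
      matchingSum (fun a b => starRingEnd ℂ (W (w a) (w b))) (S.map Fin.valEmbedding) =
        matchingSum (fun a b : Fin j => starRingEnd ℂ (W (w a) (w b))) S := fun j w S =>
    matchingSum_map Fin.valEmbedding _ (fun a b => hconj _ _) S
  simp only [hmap, hmap', Fin.valEmbedding_apply, hz, ← happ] at key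
  rw [sum_powerset_sum_powerset_subpermanent _ _ fun μ => (marginalCoeff N (p + k + 1) μ : ℂ),
    Finset.card_univ, Fintype.card_fin] at key
  rw [← key]
  refine Finset.sum_congr rfl fun y _ => ?_
  rw [← Complex.mul_conj, matchingSum_map_ringHom]
  exact congrArg (fun t => t * starRingEnd ℂ t) (hafnian_eq_matchingSum_univ _)

end

/-- Theorem 1: decomposition of the marginal probability `q_n(x_1, …, x_k)` of Gaussian boson
sampling into sums of small Hafnians and permanents. -/
theorem gbs_marginal_decomposition (m n k : ℕ) (hm : 0 < m) (hn : 0 < n)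
    (hme : Even m) (hne : Even n) (hk1 : 1 ≤ k) (hkn : k ≤ n)
    (W : Matrix (Fin m) (Fin m) ℂ) (hWsym : W.transpose = W)
    (hWunit : W * W.conjTranspose = 1) (x : Fin k → Fin m) :
    (∑ y : Fin (n - k) → Fin m,
        (Complex.normSq (hafnian (fun i j : Fin n =>
          W (Fin.append x y (Fin.cast (by omega) i))
            (Fin.append x y (Fin.cast (by omega) j)))) : ℂ))
      / ((n.factorial : ℂ) * (Nat.choose ((m + n) / 2 - 1) (n / 2) : ℂ))
    = ∑ j1 ∈ Finset.Icc (k - n / 2) (k / 2), ∑ j2 ∈ Finset.Icc (k - n / 2) (k / 2),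
        ∑ a ∈ Finset.powersetCard (2 * j1) (Finset.univ : Finset (Fin k)),
          ∑ a' ∈ Finset.powersetCard (2 * j2) (Finset.univ : Finset (Fin k)),
            hafnian (fun i j : ↥a => W (x i.1) (x j.1)) *
              hafnian (fun i j : ↥a' => starRingEnd ℂ (W (x i.1) (x j.1))) *
              ∑ μ ∈ (Finset.Icc (3 * k - 2 * (j1 + j2) - n) (k - 2 * max j1 j2)).filter
                  (fun μ => μ % 2 = k % 2),
                ((n - k).factorial : ℂ) /
                    ((n.factorial : ℂ) * (Nat.choose ((m + n) / 2 - 1) (n / 2) : ℂ)) *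
                  (Nat.choose ((n - k + μ + m) / 2 - 1) (k - j1 - j2 + m / 2 - 1) : ℂ) *
                  ∑ A ∈ Finset.powersetCard μ ((Finset.univ : Finset (Fin k)) \ a),
                    ∑ B ∈ Finset.powersetCard μ ((Finset.univ : Finset (Fin k)) \ a'),
                      perm (fun (i : ↥A) (j : ↥B) => if x i.1 = x j.1 then (1 : ℂ) else 0) *
                        hafnian (fun i j : ↥((Finset.univ : Finset (Fin k)) \ (a ∪ A)) =>
                          W (x i.1) (x j.1)) *
                        hafnian (fun i j : ↥((Finset.univ : Finset (Fin k)) \ (a' ∪ B)) =>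
                          starRingEnd ℂ (W (x i.1) (x j.1))) := by
  have hW : ∀ i j, W i j = W j i := fun i j => congrFun (congrFun hWsym j) i
  have hconj : ∀ i j, starRingEnd ℂ (W i j) = starRingEnd ℂ (W j i) := fun i j => by rw [hW]
  have hunit : ∀ i j, ∑ y, W y i * starRingEnd ℂ (W y j) = if i = j then 1 else 0 := by
    intro i j
    have h := congrFun (congrFun hWunit i) j
    rw [Matrix.mul_apply, Matrix.one_apply] at h
    rw [← h]
    refine Finset.sum_congr rfl fun y _ => ?_
    rw [Matrix.conjTranspose_apply, hW y i, hW y j]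
    rfl
  obtain ⟨p, rfl⟩ : ∃ p, m = 2 * (p + 1) := by
    obtain ⟨r, rfl⟩ := hme
    exact ⟨r - 1, by omega⟩
  have hhaf : ∀ S : Finset (Fin k), hafnian (fun i j : ↥S => W (x i.1) (x j.1)) =
      matchingSum (fun i j => W (x i) (x j)) S := fun S =>
    hafnian_subtype (fun i j => W (x i) (x j)) (fun i j => hW _ _) S
  have hhaf' : ∀ S : Finset (Fin k),
      hafnian (fun i j : ↥S => starRingEnd ℂ (W (x i.1) (x j.1))) =
        matchingSum (fun i j => starRingEnd ℂ (W (x i) (x j))) S := fun S =>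
    hafnian_subtype (fun i j => starRingEnd ℂ (W (x i) (x j))) (fun i j => hconj _ _) S
  have hperm : ∀ A B : Finset (Fin k),
      perm (fun (i : ↥A) (j : ↥B) => if x i.1 = x j.1 then (1 : ℂ) else 0) =
        subpermanent (fun i j => if x i = x j then (1 : ℂ) else 0) A B := fun A B => rfl
  rw [sum_normSq_hafnian rfl hW hunit x, ← sum_sum_sum_choose_mul hkn hne]
  refine Finset.sum_congr rfl fun j1 _ => Finset.sum_congr rfl fun j2 _ => ?_
  simp only [hhaf, hhaf', hperm]
  simp only [Finset.mul_sum (s := Finset.filter _ _)]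
  rw [Finset.sum_congr rfl fun a _ => Finset.sum_comm, Finset.sum_comm]
  refine Finset.sum_congr rfl fun μ _ => ?_
  have key := sum_sum_matchingSum_mul_sum_sum _ _ (fun i j => hW (x i) (x j))
    (fun i j => hconj (x i) (x j))
    (subpermanent fun i j => if x i = x j then (1 : ℂ) else 0) Finset.univ j1 j2 μ
  rw [Finset.card_univ, Fintype.card_fin] at key
  rw [← key, Finset.mul_sum]
  refine Finset.sum_congr rfl fun a _ => ?_
  rw [Finset.mul_sum]
  refine Finset.sum_congr rfl fun a' _ => ?_
  ring
end

section
/- Let M be a symmetric n×n complex matrix with n even, and let 0 ≤ k ≤ n. For index sets S,T ⊆ {1,…,n} let M[S,T] denote the submatrix of M with rows indexed by S and columns indexed by T (each listed in increasing order), and write M[S] := M[S,S]. Then Haf(M) = ∑_{j=max(0,k−n/2)}^{⌊k/2⌋} ∑_{a} ∑_{a'} Haf(M[a])·Haf(M[a'])·Per(M[{1,…,k}∖a, {k+1,…,n}∖a']), where a ranges over all 2j-element subsets of {1,…,k} and a' ranges over all (n−2k+2j)-element subsets of {k+1,…,n} (so that both complements {1,…,k}∖a and {k+1,…,n}∖a'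 have exactly k−2j elements). -/
section Splitting

variable {ι : Type*} [LinearOrder ι]

/-- Glue self-maps of `a` and `a'` and a bijection between `L \ a` and `R \ a'` to a self-map
of the whole index type. Indices outside `a`, `a'`, `L` and `R` are fixed. -/
def glueMap {L R a a' : Finset ι} (α : Equiv.Perm a) (β : Equiv.Perm a')
    (σ : ↥(L \ a) ≃ ↥(R \ a')) (i : ι) : ι :=
  if h : i ∈ a then α ⟨i, h⟩
  else if h : i ∈ a' then β ⟨i, h⟩
  else if h : i ∈ L \ a then σ ⟨i, h⟩
  else if h : i ∈ R \ a' then σ.symm ⟨i, h⟩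
  else i

section glueMap

variable {L R a a' : Finset ι} {α : Equiv.Perm a} {β : Equiv.Perm a'}
  {σ : ↥(L \ a) ≃ ↥(R \ a')}

theorem glueMap_left (i : a) : glueMap α β σ i = α i := by
  simp [glueMap]

theorem glueMap_right (hd : Disjoint L R) (ha : a ⊆ L) (ha' : a' ⊆ R) (i : a') :
    glueMap α β σ i = β i := by
  have h : (i : ι) ∉ a := fun h => Finset.disjoint_left.1 hd (ha h) (ha' i.2)
  simp [glueMap, h]

theorem glueMap_cross (hd : Disjoint L R) (ha' : a' ⊆ R) (i : ↥(L \ a)) :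
    glueMap α β σ i = σ i := by
  have hi := Finset.mem_sdiff.1 i.2
  have h : (i : ι) ∉ a' := fun h => Finset.disjoint_left.1 hd hi.1 (ha' h)
  simp [glueMap, h, hi.2]

theorem glueMap_cross_symm (hd : Disjoint L R) (ha : a ⊆ L) (i : ↥(R \ a')) :
    glueMap α β σ i = σ.symm i := by
  have hi := Finset.mem_sdiff.1 i.2
  have hL : (i : ι) ∉ L := fun h => Finset.disjoint_left.1 hd h hi.1
  have h : (i : ι) ∉ a := fun h => hL (ha h)
  simp [glueMap, h, hi.2, hL]

end glueMap

variable [Fintype ι]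

theorem forall_of_forall_region {L R a a' : Finset ι} (hLR : L ∪ R = Finset.univ) {p : ι → Prop}
    (hpa : ∀ i : a, p i) (hpa' : ∀ i : a', p i) (hpL : ∀ i : ↥(L \ a), p i)
    (hpR : ∀ i : ↥(R \ a'), p i) (i : ι) : p i := by
  by_cases h : i ∈ a
  · exact hpa ⟨i, h⟩
  by_cases h' : i ∈ a'
  · exact hpa' ⟨i, h'⟩
  rcases Finset.mem_union.1 (hLR ▸ Finset.mem_univ i) with hi | hi
  · exact hpL ⟨i, Finset.mem_sdiff.2 ⟨hi, h⟩⟩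
  · exact hpR ⟨i, Finset.mem_sdiff.2 ⟨hi, h'⟩⟩

theorem glueMap_involutive {L R a a' : Finset ι} (hLR : L ∪ R = Finset.univ)
    (hd : Disjoint L R) (ha : a ⊆ L) (ha' : a' ⊆ R) {α : Equiv.Perm a} {β : Equiv.Perm a'}
    (σ : ↥(L \ a) ≃ ↥(R \ a')) (hα : ∀ i, α (α i) = i) (hβ : ∀ i, β (β i) = i) :
    Function.Involutive (glueMap α β σ) := by
  refine forall_of_forall_region (a := a) (a' := a') hLR ?_ ?_ ?_ ?_ <;> intro i
  · simp only [glueMap_left, hα]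
  · simp only [glueMap_right hd ha ha', hβ]
  · simp only [glueMap_cross hd ha', glueMap_cross_symm hd ha, σ.symm_apply_apply]
  · simp only [glueMap_cross hd ha', glueMap_cross_symm hd ha, σ.apply_symm_apply]

/-- The indices of `S` that `π` matches within `S`. -/
def innerPart (π : Equiv.Perm ι) (S : Finset ι) : Finset ι :=
  S.filter (fun i => π i ∈ S)

theorem prod_glueMap {L R a a' : Finset ι} (hLR : L ∪ R = Finset.univ)
    (hlt : ∀ i ∈ L, ∀ j ∈ R, i < j) (hd : Disjoint L R) (ha : a ⊆ L) (ha' : a' ⊆ R)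
    (α : Equiv.Perm a) (β : Equiv.Perm a') (σ : ↥(L \ a) ≃ ↥(R \ a')) (M : Matrix ι ι ℂ) :
    ∏ i ∈ Finset.univ.filter (fun i => i < glueMap α β σ i), M i (glueMap α β σ i) =
      (∏ i ∈ Finset.univ.filter (fun i => i < α i), M i (α i)) *
        (∏ i ∈ Finset.univ.filter (fun i => i < β i), M i (β i)) *
          ∏ i : ↥(L \ a), M i (σ i) := by
  simp only [Finset.prod_filter]
  rw [← hLR, Finset.prod_union hd, ← Finset.prod_sdiff ha, ← Finset.prod_sdiff ha',
    ← Finset.prod_coe_sort (L \ a), ← Finset.prod_coe_sort (R \ a'), ← Finset.prod_coe_sort a,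
    ← Finset.prod_coe_sort a']
  have hσ (i : ↥(L \ a)) : (i : ι) < σ i :=
    hlt _ (Finset.mem_sdiff.1 i.2).1 _ (Finset.mem_sdiff.1 (σ i).2).1
  have hσ' (i : ↥(R \ a')) : ¬ (i : ι) < σ.symm i :=
    (hlt _ (Finset.mem_sdiff.1 (σ.symm i).2).1 _ (Finset.mem_sdiff.1 i.2).1).not_gt
  simp only [glueMap_left, glueMap_right hd ha ha', glueMap_cross hd ha',
    glueMap_cross_symm hd ha, hσ, hσ', if_true, if_false, Finset.prod_const_one,
    Subtype.coe_lt_coe]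
  ring

theorem innerPart_glueMap {L R a a' : Finset ι} (hLR : L ∪ R = Finset.univ)
    (hd : Disjoint L R) (ha : a ⊆ L) (ha' : a' ⊆ R) {α : Equiv.Perm a} {β : Equiv.Perm a'}
    (σ : ↥(L \ a) ≃ ↥(R \ a')) {π : Equiv.Perm ι} (hπ : ∀ i, π i = glueMap α β σ i) :
    innerPart π L = a ∧ innerPart π R = a' := by
  have hL {i} (h : i ∈ L) : i ∉ R := Finset.disjoint_left.1 hd h
  have hR {i} (h : i ∈ R) : i ∉ L := Finset.disjoint_right.1 hd h
  constructor <;> ext i <;> simp only [innerPart, Finset.mem_filter, hπ] <;>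
  revert i <;>
  refine forall_of_forall_region (a := a) (a' := a') hLR ?_ ?_ ?_ ?_ <;> intro i
  · simp [glueMap_left, ha i.2, ha (α i).2]
  · have := hR (ha' i.2)
    simp [this, mt (@ha _) this]
  · have := Finset.mem_sdiff.1 i.2
    simp [glueMap_cross hd ha', this, hR (Finset.mem_sdiff.1 (σ i).2).1]
  · have := hR (Finset.mem_sdiff.1 i.2).1
    simp [this, mt (@ha _) this]
  · have := hL (ha i.2)
    simp [this, mt (@ha' _) this]
  · simp [glueMap_right hd ha ha', ha' i.2, ha' (β i).2]
  · have := hL (Finset.mem_sdiff.1 i.2).1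
    simp [this, mt (@ha' _) this]
  · have := Finset.mem_sdiff.1 i.2
    simp [glueMap_cross_symm hd ha, this, hL (Finset.mem_sdiff.1 (σ.symm i).2).1]

theorem exists_glueMap_eq {L R : Finset ι} (hLR : L ∪ R = Finset.univ)
    (hd : Disjoint L R) {π : Equiv.Perm ι} (hπ : ∀ i, π (π i) = i) :
    ∃ (α : Equiv.Perm (innerPart π L)) (β : Equiv.Perm (innerPart π R))
      (σ : ↥(L \ innerPart π L) ≃ ↥(R \ innerPart π R)),
      (∀ i, (α i : ι) = π i) ∧ (∀ i, (β i : ι) = π i) ∧ ∀ i, glueMap α β σ i = π i := by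
  have hmem (S : Finset ι) (i : ι) : π i ∈ innerPart π S ↔ i ∈ innerPart π S := by
    simp [innerPart, hπ, and_comm]
  have hor (i : ι) : i ∈ L ∨ i ∈ R := Finset.mem_union.1 (hLR ▸ Finset.mem_univ i)
  have hL {i} (h : i ∈ L) : i ∉ R := Finset.disjoint_left.1 hd h
  have hcross (i : ι) : i ∈ L \ innerPart π L → π i ∈ R \ innerPart π R := by
    have hi := hor (π i)
    have hi' := @hL i
    simp only [innerPart, Finset.mem_sdiff, Finset.mem_filter, hπ]
    tauto
  have hcross' (i : ι) : i ∈ R \ innerPart π R → π i ∈ L \ innerPart π L := by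
    have hi := hor (π i)
    have hi' := @hL i
    simp only [innerPart, Finset.mem_sdiff, Finset.mem_filter, hπ]
    tauto
  let σ : ↥(L \ innerPart π L) ≃ ↥(R \ innerPart π R) :=
    { toFun i := ⟨π i, hcross _ i.2⟩
      invFun i := ⟨π i, hcross' _ i.2⟩
      left_inv i := Subtype.ext (hπ i)
      right_inv i := Subtype.ext (hπ i) }
  refine ⟨π.subtypePerm (hmem L), π.subtypePerm (hmem R), σ, fun _ => rfl, fun _ => rfl, ?_⟩
  have ha : innerPart π L ⊆ L := Finset.filter_subset _ _
  have ha' : innerPart π R ⊆ R := Finset.filter_subset _ _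
  refine forall_of_forall_region (a := innerPart π L) (a' := innerPart π R) hLR ?_ ?_ ?_ ?_ <;>
    intro i
  · rw [glueMap_left]; rfl
  · rw [glueMap_right hd ha ha']; rfl
  · rw [glueMap_cross hd ha']; rfl
  · rw [glueMap_cross_symm hd ha]; rfl

theorem sum_matchings_innerPart {L R a a' : Finset ι} (hLR : L ∪ R = Finset.univ)
    (hlt : ∀ i ∈ L, ∀ j ∈ R, i < j) (hd : Disjoint L R) (ha : a ⊆ L) (ha' : a' ⊆ R)
    (M : Matrix ι ι ℂ) :
    ∑ π ∈ (Finset.univ.filter (fun π : Equiv.Perm ι => ∀ i, π (π i) = i ∧ π i ≠ i)).filter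
        (fun π => (innerPart π L, innerPart π R) = (a, a')),
      ∏ i ∈ Finset.univ.filter (fun i => i < π i), M i (π i) =
    hafnian (fun i j : a => M i j) * hafnian (fun i j : a' => M i j) *
      perm (fun (i : ↥(L \ a)) (j : ↥(R \ a')) => M i j) := by
  simp only [hafnian, perm]
  rw [Finset.sum_mul_sum, ← Finset.sum_product', Finset.sum_mul_sum, ← Finset.sum_product']
  symm
  have hinv : ∀ x ∈ ((Finset.univ.filter fun α : Equiv.Perm a => ∀ i, α (α i) = i ∧ α i ≠ i) ×ˢ
      (Finset.univ.filter fun β : Equiv.Perm a' => ∀ i, β (β i) = i ∧ β i ≠ i)) ×ˢ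
      (Finset.univ : Finset (↥(L \ a) ≃ ↥(R \ a'))),
      Function.Involutive (glueMap x.1.1 x.1.2 x.2) := by
    rintro ⟨⟨α, β⟩, σ⟩ h
    simp only [Finset.mem_product, Finset.mem_filter, Finset.mem_univ, true_and, and_true] at h
    exact glueMap_involutive hLR hd ha ha' σ (fun i => (h.1 i).1) (fun i => (h.2 i).1)
  refine Finset.sum_bij (fun x hx => (hinv x hx).toPerm) ?_ ?_ ?_ ?_
  · rintro ⟨⟨α, β⟩, σ⟩ h
    have hi := hinv _ h
    simp only [Finset.mem_product, Finset.mem_filter, Finset.mem_univ, true_and, and_true] at h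
    have hp := innerPart_glueMap hLR hd ha ha' σ (π := hi.toPerm) (fun i => rfl)
    simp only [Finset.mem_filter, Finset.mem_univ, true_and, hp, and_true]
    refine fun i => ⟨hi i, ?_⟩
    change glueMap α β σ i ≠ i
    revert i
    refine forall_of_forall_region (a := a) (a' := a') hLR ?_ ?_ ?_ ?_ <;> intro i
    · rw [glueMap_left, Ne, Subtype.coe_inj]
      exact (h.1 i).2
    · rw [glueMap_right hd ha ha', Ne, Subtype.coe_inj]
      exact (h.2 i).2
    · rw [glueMap_cross hd ha']
      exact (hlt _ (Finset.mem_sdiff.1 i.2).1 _ (Finset.mem_sdiff.1 (σ i).2).1).ne'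
    · rw [glueMap_cross_symm hd ha]
      exact (hlt _ (Finset.mem_sdiff.1 (σ.symm i).2).1 _ (Finset.mem_sdiff.1 i.2).1).ne
  · rintro ⟨⟨α, β⟩, σ⟩ _ ⟨⟨α₁, β₁⟩, σ₁⟩ _ heq
    have h (i : ι) : glueMap α β σ i = glueMap α₁ β₁ σ₁ i := DFunLike.congr_fun heq i
    have h1 : α = α₁ := by
      ext i
      simpa only [glueMap_left] using h i
    have h2 : β = β₁ := by
      ext i
      simpa only [glueMap_right hd ha ha'] using h i
    have h3 : σ = σ₁ := by
      ext i
      simpa only [glueMap_cross hd ha'] using h i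
    rw [h1, h2, h3]
  · intro π hπ
    simp only [Finset.mem_filter, Finset.mem_univ, true_and, Prod.mk.injEq] at hπ
    obtain ⟨hm, rfl, rfl⟩ := hπ
    obtain ⟨α, β, σ, hα, hβ, hg⟩ := exists_glueMap_eq hLR hd (fun i => (hm i).1)
    refine ⟨((α, β), σ), ?_, Equiv.ext hg⟩
    simp only [Finset.mem_product, Finset.mem_filter, Finset.mem_univ, true_and, and_true,
      ne_eq, Subtype.ext_iff, hα, hβ]
    exact ⟨fun i => hm i, fun i => hm i⟩
  · rintro ⟨⟨α, β⟩, σ⟩ _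
    exact (prod_glueMap hLR hlt hd ha ha' α β σ M).symm

theorem hafnian_eq_sum_powerset {L R : Finset ι} (hLR : L ∪ R = Finset.univ)
    (hlt : ∀ i ∈ L, ∀ j ∈ R, i < j) (M : Matrix ι ι ℂ) :
    hafnian M = ∑ a ∈ L.powerset, ∑ a' ∈ R.powerset,
      hafnian (fun i j : a => M i j) * hafnian (fun i j : a' => M i j) *
        perm (fun (i : ↥(L \ a)) (j : ↥(R \ a')) => M i j) := by
  have hd : Disjoint L R := Finset.disjoint_left.2 fun i hL hR => (hlt i hL i hR).false
  rw [← Finset.sum_product', hafnian, ← Finset.sum_fiberwise_of_maps_to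
    (t := L.powerset ×ˢ R.powerset) (g := fun π => (innerPart π L, innerPart π R))]
  · refine Finset.sum_congr rfl fun p hp => ?_
    rw [Finset.mem_product, Finset.mem_powerset, Finset.mem_powerset] at hp
    exact sum_matchings_innerPart hLR hlt hd hp.1 hp.2 M
  · intro π _
    simp [innerPart, Finset.filter_subset]

theorem hafnian_eq_zero_of_odd_card (V : Matrix ι ι ℂ) (h : Odd (Fintype.card ι)) :
    hafnian V = 0 := by
  refine Finset.sum_eq_zero fun π hπ => ?_
  simp only [Finset.mem_filter, Finset.mem_univ, true_and] at hπ
  refine absurd ?_ (Nat.not_even_iff_odd.2 h)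
  have hsum : ∑ _i : ι, (1 : ZMod 2) = 0 :=
    Finset.sum_involution (fun i _ => π i) (fun _ _ => by decide) (fun i _ _ => (hπ i).2)
      (fun _ _ => Finset.mem_univ _) (fun i _ => (hπ i).1)
  rw [← ZMod.natCast_eq_zero_iff_even]
  simpa using hsum

end Splitting

theorem perm_eq_zero_of_card_ne {ι κ : Type*} [Fintype ι] [Fintype κ] [DecidableEq ι]
    [DecidableEq κ] (M : Matrix ι κ ℂ) (h : Fintype.card ι ≠ Fintype.card κ) : perm M = 0 := by
  have : IsEmpty (ι ≃ κ) := ⟨fun e => h (Fintype.card_congr e)⟩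
  simp [perm]

/-- Splitting a big Hafnian into Hafnians and permanents of smaller submatrices:
the Hafnian of a symmetric `n × n` matrix (`n` even) decomposes, for any `0 ≤ k ≤ n`, over
matchings internal to the first `k` indices, internal to the last `n - k` indices, and across. -/
theorem hafnian_split (n k : ℕ) (hne : Even n) (hkn : k ≤ n)
    (M : Matrix (Fin n) (Fin n) ℂ) (hMsym : M.transpose = M) :
    hafnian M =
      ∑ j ∈ Finset.Icc (k - n / 2) (k / 2),
        ∑ a ∈ Finset.powersetCard (2 * j)
            ((Finset.univ : Finset (Fin n)).filter (fun i : Fin n => (i : ℕ) < k)),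
          ∑ a' ∈ Finset.powersetCard (n + 2 * j - 2 * k)
              ((Finset.univ : Finset (Fin n)).filter (fun i : Fin n => k ≤ (i : ℕ))),
            hafnian (fun i j : ↥a => M i.1 j.1) * hafnian (fun i j : ↥a' => M i.1 j.1) *
              perm (fun (i : ↥(((Finset.univ : Finset (Fin n)).filter
                        (fun i : Fin n => (i : ℕ) < k)) \ a))
                    (j : ↥(((Finset.univ : Finset (Fin n)).filter
                        (fun i : Fin n => k ≤ (i : ℕ))) \ a')) => M i.1 j.1) := by
  set L := (Finset.univ : Finset (Fin n)).filter (fun i : Fin n => (i : ℕ) < k) with hL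
  set R := (Finset.univ : Finset (Fin n)).filter (fun i : Fin n => k ≤ (i : ℕ)) with hR
  have hLR : L ∪ R = Finset.univ := by
    ext i
    simp [hL, hR, lt_or_ge]
  have hlt : ∀ i ∈ L, ∀ j ∈ R, i < j := by
    intro i hi j hj
    simp only [hL, hR, Finset.mem_filter, Finset.mem_univ, true_and] at hi hj
    exact Fin.lt_def.2 (hi.trans_le hj)
  have hd : Disjoint L R := Finset.disjoint_left.2 fun i hi hj => (hlt i hi i hj).false
  have hLc : L.card = k := by
    simp [hL, Fin.card_filter_val_lt, hkn]
  have hRc : L.card + R.card = n := by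
    rw [← Finset.card_union_of_disjoint hd, hLR, Finset.card_univ, Fintype.card_fin]
  obtain ⟨m, rfl⟩ := hne
  rw [hafnian_eq_sum_powerset hLR hlt]
  have hzero (a a' : Finset (Fin (m + m))) (ha : a ⊆ L) (ha' : a' ⊆ R)
      (hne0 : hafnian (fun i j : ↥a => M i.1 j.1) * hafnian (fun i j : ↥a' => M i.1 j.1) *
        perm (fun (i : ↥(L \ a)) (j : ↥(R \ a')) => M i.1 j.1) ≠ 0) :
      Even a.card ∧ k + a'.card = m + m - k + a.card := by
    constructor
    · by_contra h
      refine hne0 ?_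
      exact mul_eq_zero_of_left (mul_eq_zero_of_left
        (hafnian_eq_zero_of_odd_card _ (by simpa using h)) _) _
    · by_contra h
      refine hne0 ?_
      refine mul_eq_zero_of_right _ (perm_eq_zero_of_card_ne _ ?_)
      have h1 := Finset.card_le_card ha
      have h2 := Finset.card_le_card ha'
      rw [Fintype.card_coe, Fintype.card_coe, Finset.card_sdiff_of_subset ha,
        Finset.card_sdiff_of_subset ha']
      omega
  simp only [Finset.sum_sigma']
  symm
  refine Finset.sum_bij_ne_zero (fun x _ _ => ⟨x.2.1, x.2.2⟩) ?_ ?_ ?_ ?_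
  · rintro ⟨j, a, a'⟩ h _
    simp only [Finset.mem_sigma, Finset.mem_powersetCard, Finset.mem_powerset] at h ⊢
    exact ⟨h.2.1.1, h.2.2.1⟩
  · rintro ⟨j, a, a'⟩ h _ ⟨j₁, a₁, a₁'⟩ h₁ _ heq
    simp only [Finset.mem_sigma, Finset.mem_powersetCard] at h h₁
    simp only [Sigma.mk.injEq, heq_eq_eq] at heq ⊢
    obtain ⟨rfl, rfl⟩ := heq
    exact ⟨by omega, rfl, rfl⟩
  · rintro ⟨a, a'⟩ h hne0
    simp only [Finset.mem_sigma, Finset.mem_powerset] at h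
    obtain ⟨⟨j, hj⟩, hcard⟩ := hzero a a' h.1 h.2 hne0
    have h1 := Finset.card_le_card h.1
    refine ⟨⟨j, a, a'⟩, ?_, hne0, rfl⟩
    simp only [Finset.mem_sigma, Finset.mem_powersetCard, Finset.mem_Icc]
    refine ⟨⟨?_, ?_⟩, ⟨h.1, ?_⟩, h.2, ?_⟩ <;> omega
  · intros
    rfl
end

section
/- Let m and n be even positive integers and let W be an m×m symmetric unitary complex matrix. Then ∑_{x ∈ {1,…,m}^n} |Haf(W_x)|² = n! · C((m+n)/2 − 1, n/2). (Equivalently, the function q_n(x) := |Haf(W_x)|² / (n!·C((m+n)/2−1, n/2)) is a probability distribution on {1,…,m}^n.) -/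
open Finset in
/-- The Hafnian of a symmetric matrix does not depend on the ordering of its index type. -/
theorem hafnian_reindex {ι κ : Type*} [Fintype ι] [LinearOrder ι] [Fintype κ] [LinearOrder κ]
    (e : ι ≃ κ) (V : Matrix κ κ ℂ) (hV : ∀ i j, V i j = V j i) :
    hafnian (fun i j : ι => V (e i) (e j)) = hafnian V := by
  unfold hafnian
  refine sum_equiv e.permCongr ?_ ?_
  · intro π
    simp only [mem_filter, mem_univ, true_and]
    constructor
    · intro h k
      have := h (e.symm k)
      simp only [Equiv.permCongr_apply, Equiv.symm_apply_apply, this.1, Equiv.apply_symm_apply,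
        true_and]
      intro h'
      exact this.2 (e.eq_symm_apply.2 h')
    · intro h i
      have := h (e i)
      simpa [Equiv.permCongr_apply] using this
  · intro π hπ
    simp only [mem_filter, mem_univ, true_and] at hπ
    refine prod_bij' (fun i _ => if e i < e (π i) then e i else e (π i))
      (fun k _ => if e.symm k < π (e.symm k) then e.symm k else π (e.symm k)) ?_ ?_ ?_ ?_ ?_
    · intro i hi
      simp only [mem_filter, mem_univ, true_and] at hi ⊢
      simp only [Equiv.permCongr_apply]
      split_ifs with h
      · simpa using h
      · have hne : e (π i) ≠ e i := fun h' => (hπ i).2 (e.injective h')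
        simpa [(hπ i).1] using lt_of_le_of_ne (not_lt.1 h) hne
    · intro k hk
      simp only [mem_filter, mem_univ, true_and] at hk ⊢
      split_ifs with h
      · exact h
      · rw [(hπ _).1]
        exact lt_of_le_of_ne (not_lt.1 h) (hπ _).2
    · intro i hi
      simp only [mem_filter, mem_univ, true_and] at hi
      split_ifs <;> simp_all [not_lt_of_gt]
    · intro k hk
      simp only [mem_filter, mem_univ, true_and] at hk
      simp only [Equiv.permCongr_apply] at hk
      split_ifs with h₁ h₂ h₂
      · simp
      · exact absurd (by simpa using hk) h₂
      · rw [(hπ _).1, Equiv.apply_symm_apply] at h₂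
        exact absurd h₂ hk.not_gt
      · simp [(hπ _).1]
    · intro i hi
      simp only [Equiv.permCongr_apply]
      split_ifs with h
      · simp
      · simp [(hπ i).1, hV (e i)]

open Finset in
/-- The contribution to the Hafnian of the matchings containing a given pair. -/
theorem sum_matchings_with_pair {ι : Type*} [Fintype ι] [LinearOrder ι] (V : Matrix ι ι ℂ)
    {a b : ι} (hab : a < b) :
    ∑ π ∈ univ.filter (fun π : Equiv.Perm ι => (∀ i, π (π i) = i ∧ π i ≠ i) ∧ π a = b),
      ∏ i ∈ univ.filter (fun i => i < π i), V i (π i)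
      = V a b * hafnian (fun i j : {i : ι // i ≠ a ∧ i ≠ b} => V i j) := by
  unfold hafnian
  rw [mul_sum]
  have hstab : ∀ π : Equiv.Perm ι, ((∀ i, π (π i) = i ∧ π i ≠ i) ∧ π a = b) →
      ∀ i, (π i ≠ a ∧ π i ≠ b) ↔ (i ≠ a ∧ i ≠ b) := by
    rintro π ⟨h, rfl⟩ i
    have : π i = a ↔ i = π a := by
      constructor
      · intro h'; rw [← h', (h i).1]
      · rintro rfl; exact (h a).1
    simp only [ne_eq, this, EmbeddingLike.apply_eq_iff_eq]
    tauto
  have hval : ∀ (σ : Equiv.Perm {i : ι // i ≠ a ∧ i ≠ b}) (i : {i : ι // i ≠ a ∧ i ≠ b}),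
      (Equiv.swap a b * Equiv.Perm.ofSubtype σ) i = σ i := by
    intro σ i
    rw [Equiv.Perm.mul_apply, Equiv.Perm.ofSubtype_apply_coe,
      Equiv.swap_apply_of_ne_of_ne (σ i).2.1 (σ i).2.2]
  have hvala : ∀ (σ : Equiv.Perm {i : ι // i ≠ a ∧ i ≠ b}),
      (Equiv.swap a b * Equiv.Perm.ofSubtype σ) a = b := by
    intro σ
    rw [Equiv.Perm.mul_apply, Equiv.Perm.ofSubtype_apply_of_not_mem _ (by simp),
      Equiv.swap_apply_left]
  have hvalb : ∀ (σ : Equiv.Perm {i : ι // i ≠ a ∧ i ≠ b}),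
      (Equiv.swap a b * Equiv.Perm.ofSubtype σ) b = a := by
    intro σ
    rw [Equiv.Perm.mul_apply, Equiv.Perm.ofSubtype_apply_of_not_mem _ (by simp),
      Equiv.swap_apply_right]
  refine sum_bij' (fun π hπ => π.subtypePerm (hstab π (by simpa using hπ)))
    (fun σ _ => Equiv.swap a b * Equiv.Perm.ofSubtype σ) ?_ ?_ ?_ ?_ ?_
  · intro π hπ
    simp only [mem_filter, mem_univ, true_and] at hπ ⊢
    intro i
    simp [Subtype.ext_iff, hπ.1 i]
  · intro σ hσ
    simp only [mem_filter, mem_univ, true_and] at hσ ⊢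
    refine ⟨fun i => ?_, hvala σ⟩
    by_cases hia : i = a
    · rw [hia, hvala, hvalb]
      exact ⟨rfl, hab.ne'⟩
    by_cases hib : i = b
    · rw [hib, hvalb, hvala]
      exact ⟨rfl, hab.ne⟩
    · have h1 := hval σ ⟨i, hia, hib⟩
      simp only at h1
      rw [h1, hval, (hσ _).1]
      exact ⟨rfl, fun h => (hσ ⟨i, hia, hib⟩).2 (Subtype.ext h)⟩
  · intro π hπ
    simp only [mem_filter, mem_univ, true_and] at hπ
    ext i
    by_cases hia : i = a
    · rw [hia, hvala, hπ.2]
    by_cases hib : i = b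
    · rw [hib, hvalb, ← hπ.2, (hπ.1 a).1]
    · exact hval _ ⟨i, hia, hib⟩
  · intro σ hσ
    ext i
    exact hval σ i
  · intro π hπ
    simp only [mem_filter, mem_univ, true_and] at hπ
    have hpb : π b = a := by rw [← hπ.2, (hπ.1 a).1]
    have hset : univ.filter (fun i => i < π i) = insert a
        ((univ.filter fun i : {i : ι // i ≠ a ∧ i ≠ b} => (i : ι) < π i).map
          (Function.Embedding.subtype _)) := by
      ext i
      simp only [mem_filter, mem_univ, true_and, mem_insert, mem_map,
        Function.Embedding.coe_subtype, Subtype.exists, exists_and_left, exists_prop,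
        exists_eq_right_right]
      by_cases hia : i = a
      · simp [hia, hπ.2, hab]
      by_cases hib : i = b
      · simp [hib, hpb, hab.le, hab.ne']
      · simp [hia, hib]
    rw [hset, prod_insert (by simp), prod_map]
    congr 1
    rw [hπ.2]

open Finset in
/-- Expansion of the Hafnian along the row of the least index. -/
theorem hafnian_expand_least {ι : Type*} [Fintype ι] [LinearOrder ι] (V : Matrix ι ι ℂ)
    {a : ι} (ha : ∀ i, i ≠ a → a < i) :
    hafnian V = ∑ b ∈ univ.filter (fun b => a < b),
      V a b * hafnian (fun i j : {i : ι // i ≠ a ∧ i ≠ b} => V i j) := by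
  rw [sum_congr rfl fun b hb => (sum_matchings_with_pair V (mem_filter.1 hb).2).symm]
  unfold hafnian
  simp only [← filter_filter]
  rw [sum_fiberwise_of_maps_to]
  intro π hπ
  simp only [mem_filter, mem_univ, true_and] at hπ ⊢
  exact ha _ (hπ a).2

open Finset in
/-- Expansion of the Hafnian of a symmetric matrix along its first row. -/
theorem hafnian_succ_succ {k : ℕ} (V : Matrix (Fin (k + 2)) (Fin (k + 2)) ℂ)
    (hV : ∀ i j, V i j = V j i) :
    hafnian V = ∑ j : Fin (k + 1), V 0 j.succ *
      hafnian (fun p q : Fin k => V (j.succAbove p).succ (j.succAbove q).succ) := by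
  have hterm : ∀ j : Fin (k + 1),
      hafnian (fun p q : Fin k => V (j.succAbove p).succ (j.succAbove q).succ)
        = hafnian (fun p q : {i : Fin (k + 2) // i ≠ 0 ∧ i ≠ j.succ} => V p q) := by
    intro j
    have hb : Function.Bijective (fun p : Fin k =>
        (⟨(j.succAbove p).succ, Fin.succ_ne_zero _,
          fun h => Fin.succAbove_ne j p (Fin.succ_injective _ h)⟩ :
            {i : Fin (k + 2) // i ≠ 0 ∧ i ≠ j.succ})) := by
      constructor
      · intro p q h
        simpa using h
      · rintro ⟨i, h0, hj⟩
        obtain ⟨i, rfl⟩ := Fin.exists_succ_eq.2 h0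
        obtain ⟨p, rfl⟩ := Fin.exists_succAbove_eq (x := i) (y := j) (fun h => hj (by rw [h]))
        exact ⟨p, rfl⟩
    exact hafnian_reindex (Equiv.ofBijective _ hb)
      (fun p q : {i : Fin (k + 2) // i ≠ 0 ∧ i ≠ j.succ} => V p q) (fun p q => hV p q)
  simp only [hterm]
  rw [hafnian_expand_least V (a := 0) (fun i hi => Fin.pos_of_ne_zero hi), sum_filter,
    Fin.sum_univ_succ]
  simp

section Normalization

variable {α : Type*} (W : Matrix α α ℂ)

/-- The Hafnian of the matrix `W` with rows and columns selected (with repetition) by `x`. -/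
noncomputable def hafnianAt {n : ℕ} (x : Fin n → α) : ℂ :=
  hafnian (fun i j : Fin n => W (x i) (x j))

theorem hafnianAt_cons {k : ℕ} (hW : W.transpose = W) (p : α) (z : Fin (k + 1) → α) :
    hafnianAt W (Fin.cons p z : Fin (k + 2) → α)
      = ∑ j, W p (z j) * hafnianAt W (j.removeNth z) := by
  refine (hafnian_succ_succ (fun i j => W ((Fin.cons p z : Fin (k + 2) → α) i)
    ((Fin.cons p z : Fin (k + 2) → α) j))
    (fun i j => by conv_lhs => rw [← hW, Matrix.transpose_apply])).trans ?_
  simp [hafnianAt, Fin.removeNth]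

theorem hafnianAt_comp_equiv {n : ℕ} (hW : W.transpose = W) (x : Fin n → α)
    (e : Equiv.Perm (Fin n)) : hafnianAt W (x ∘ e) = hafnianAt W x :=
  hafnian_reindex e (fun i j : Fin n => W (x i) (x j))
    (fun i j => by conv_lhs => rw [← hW, Matrix.transpose_apply])

theorem hafnianAt_insertNth {k : ℕ} (hW : W.transpose = W) (j : Fin (k + 1)) (q : α)
    (y : Fin k → α) :
    hafnianAt W (j.insertNth q y : Fin (k + 1) → α)
      = hafnianAt W (Fin.cons q y : Fin (k + 1) → α) := by
  rw [← hafnianAt_comp_equiv W hW (Fin.cons q y) ((finSuccEquiv' j).trans (finSuccEquiv k).symm)]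
  congr 1
  ext i
  refine Fin.succAboveCases j ?_ (fun i => ?_) i <;> simp

theorem hafnianAt_cons_insertNth {k : ℕ} (hW : W.transpose = W) (j : Fin (k + 1)) (p q : α)
    (y : Fin k → α) :
    hafnianAt W (Fin.cons p (j.insertNth q y : Fin (k + 1) → α) : Fin (k + 2) → α)
      = hafnianAt W (Fin.cons p (Fin.cons q y : Fin (k + 1) → α) : Fin (k + 2) → α) := by
  let e : Equiv.Perm (Fin (k + 1)) := (finSuccEquiv' j).trans (finSuccEquiv k).symm
  rw [← hafnianAt_comp_equiv W hW (Fin.cons p (Fin.cons q y : Fin (k + 1) → α))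
    ((finSuccEquiv (k + 1)).trans (e.optionCongr.trans (finSuccEquiv (k + 1)).symm))]
  congr 1
  ext i
  refine Fin.cases ?_ (fun i => ?_) i
  · simp
  · have : ((finSuccEquiv (k + 1)).trans (e.optionCongr.trans (finSuccEquiv (k + 1)).symm))
        i.succ = (e i).succ := by simp
    rw [Function.comp_apply, this]
    refine Fin.succAboveCases j ?_ (fun i => ?_) i <;> simp [e]

variable [Fintype α] [DecidableEq α]

/-- Contracting two arguments of the Hafnian with the conjugate of a symmetric unitary matrix. -/
theorem sum_star_mul_hafnianAt_cons_cons {k : ℕ} (hW : W.transpose = W)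
    (hU : W * W.conjTranspose = 1) (y : Fin k → α) :
    ∑ p, ∑ q, star (W p q) *
        hafnianAt W (Fin.cons p (Fin.cons q y : Fin (k + 1) → α) : Fin (k + 2) → α)
      = ((Fintype.card α + k : ℕ) : ℂ) * hafnianAt W y := by
  have hS : ∀ i j, W i j = W j i := fun i j => by conv_lhs => rw [← hW, Matrix.transpose_apply]
  have horth : ∀ q r, ∑ p, star (W p q) * W p r = if q = r then 1 else 0 := by
    intro q r
    have := congrFun (congrFun hU r) q
    rw [Matrix.mul_apply, Matrix.one_apply] at this
    simp only [eq_comm (a := r)] at this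
    rw [← this]
    refine Finset.sum_congr rfl fun p _ => ?_
    rw [Matrix.conjTranspose_apply, hS p q, hS p r, mul_comm]
  have hcontr : ∀ (r : α) (f : α → ℂ), ∑ p, ∑ q, star (W p q) * (W p r * f q) = f r := by
    intro r f
    rw [Finset.sum_comm]
    simp_rw [← mul_assoc, ← Finset.sum_mul, horth]
    simp
  have htrace : ∑ p, ∑ q, star (W p q) * (W p q * hafnianAt W y)
      = Fintype.card α * hafnianAt W y := by
    rw [Finset.sum_comm]
    simp_rw [← mul_assoc, ← Finset.sum_mul, horth]
    simp
  simp_rw [hafnianAt_cons W hW, Fin.sum_univ_succ, mul_add, Finset.sum_add_distrib]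
  simp only [Fin.cons_zero, Fin.cons_succ, Fin.removeNth_zero, Fin.tail_cons]
  rw [htrace]
  push_cast
  rw [add_mul]
  congr 1
  cases k with
  | zero => simp
  | succ k =>
    simp_rw [Finset.mul_sum]
    rw [Finset.sum_comm_cycle]
    have : ∀ i : Fin (k + 1), ∀ q : α, i.succ.removeNth (Fin.cons q y : Fin (k + 2) → α)
        = (Fin.cons q (i.removeNth y) : Fin (k + 1) → α) := by
      intro i q
      ext l
      refine Fin.cases ?_ (fun l => ?_) l <;> simp [Fin.removeNth]
    have hself : ∀ i : Fin (k + 1),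
        hafnianAt W (Fin.cons (y i) (i.removeNth y) : Fin (k + 1) → α) = hafnianAt W y := by
      intro i
      rw [← hafnianAt_insertNth W hW i, Fin.insertNth_self_removeNth]
    simp_rw [this, hcontr, hself]
    simp

/-- Recursion for the second moment of the Hafnian. -/
theorem sum_star_hafnianAt_mul_hafnianAt_succ_succ (k : ℕ) (hW : W.transpose = W)
    (hU : W * W.conjTranspose = 1) :
    ∑ x : Fin (k + 2) → α, star (hafnianAt W x) * hafnianAt W x
      = ((k + 1) * (Fintype.card α + k) : ℕ) *
        ∑ y : Fin k → α, star (hafnianAt W y) * hafnianAt W y := by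
  have hterm : ∀ j : Fin (k + 1), ∑ p, ∑ z : Fin (k + 1) → α,
      star (hafnianAt W (Fin.cons p z : Fin (k + 2) → α)) *
        (W p (z j) * hafnianAt W (j.removeNth z))
      = ((Fintype.card α + k : ℕ) : ℂ) *
        ∑ y : Fin k → α, star (hafnianAt W y) * hafnianAt W y := by
    intro j
    calc
      _ = ∑ p, ∑ q, ∑ y : Fin k → α,
          star (hafnianAt W (Fin.cons p (Fin.cons q y : Fin (k + 1) → α) : Fin (k + 2) → α)) *
            (W p q * hafnianAt W y) := by
        refine Finset.sum_congr rfl fun p _ => ?_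
        rw [← (Fin.insertNthEquiv (fun _ => α) j).sum_comp, Fintype.sum_prod_type]
        simp [Fin.insertNthEquiv, hafnianAt_cons_insertNth W hW]
      _ = ∑ y : Fin k → α, star (∑ p, ∑ q, star (W p q) *
          hafnianAt W (Fin.cons p (Fin.cons q y : Fin (k + 1) → α) : Fin (k + 2) → α)) *
            hafnianAt W y := by
        rw [Finset.sum_comm_cycle]
        simp_rw [star_sum, Finset.sum_mul]
        refine Finset.sum_congr rfl fun y _ => Finset.sum_congr rfl fun p _ =>
          Finset.sum_congr rfl fun q _ => ?_
        rw [star_mul', star_star]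
        ring
      _ = _ := by
        simp_rw [sum_star_mul_hafnianAt_cons_cons W hW hU, star_mul', star_natCast, mul_assoc,
          Finset.mul_sum]
  rw [← (Fin.consEquiv (fun _ => α)).sum_comp, Fintype.sum_prod_type]
  have : ∀ (p : α) (z : Fin (k + 1) → α),
      star (hafnianAt W (Fin.cons p z : Fin (k + 2) → α)) *
        hafnianAt W (Fin.cons p z : Fin (k + 2) → α)
      = ∑ j, star (hafnianAt W (Fin.cons p z : Fin (k + 2) → α)) *
        (W p (z j) * hafnianAt W (j.removeNth z)) := by
    intro p z
    rw [← Finset.mul_sum, ← hafnianAt_cons W hW]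
  simp only [Fin.consEquiv, Equiv.coe_fn_mk, this]
  rw [Finset.sum_comm_cycle]
  refine (Finset.sum_congr rfl fun j _ => hterm j).trans ?_
  simp [mul_assoc]

/-- The second moment of the Hafnian of a symmetric unitary matrix of even size. -/
theorem sum_star_hafnianAt_mul_hafnianAt (k m : ℕ) (hm : 0 < m) (hcard : Fintype.card α = 2 * m)
    (hW : W.transpose = W) (hU : W * W.conjTranspose = 1) :
    ∑ x : Fin (2 * k) → α, star (hafnianAt W x) * hafnianAt W x
      = (((2 * k).factorial * (m + k - 1).choose k : ℕ) : ℂ) := by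
  induction k with
  | zero => simp [hafnianAt, hafnian]
  | succ k ih =>
    rw [show 2 * (k + 1) = 2 * k + 2 from rfl,
      sum_star_hafnianAt_mul_hafnianAt_succ_succ W _ hW hU, ih, hcard]
    norm_cast
    obtain ⟨m, rfl⟩ : ∃ l, m = l + 1 := ⟨m - 1, by omega⟩
    have h := Nat.add_one_mul_choose_eq (m + k) k
    rw [show m + 1 + k - 1 = m + k by omega, show m + 1 + (k + 1) - 1 = m + k + 1 by omega,
      Nat.factorial_succ, Nat.factorial_succ]
    linear_combination 2 * (2 * k + 1) * (2 * k).factorial * h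

end Normalization

/-- Normalization of `q_n`: for a symmetric unitary `m × m` matrix `W` (with `m`, `n` even
and positive), `∑_{x ∈ [m]^n} |Haf(W_x)|² = n! · C((m+n)/2 − 1, n/2)`. -/
theorem hafnian_normalization (m n : ℕ) (hm : 0 < m) (hn : 0 < n)
    (hme : Even m) (hne : Even n)
    (W : Matrix (Fin m) (Fin m) ℂ) (hWsym : W.transpose = W)
    (hWunit : W * W.conjTranspose = 1) :
    ∑ x : Fin n → Fin m,
        Complex.normSq (hafnian (fun i j : Fin n => W (x i) (x j)))
      = (n.factorial : ℝ) * (Nat.choose ((m + n) / 2 - 1) (n / 2) : ℝ) := by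
  obtain ⟨l, rfl⟩ := hme.two_dvd
  obtain ⟨k, rfl⟩ := hne.two_dvd
  have h := sum_star_hafnianAt_mul_hafnianAt W k l (by omega) (by simp) hWsym hWunit
  rw [show (2 * l + 2 * k) / 2 = l + k by omega, show 2 * k / 2 = k by omega]
  apply Complex.ofReal_injective
  push_cast at h ⊢
  rw [← h]
  refine Finset.sum_congr rfl fun x _ => ?_
  rw [Complex.normSq_eq_conj_mul_self]
  rfl
end

section
/- For all natural numbers M ≥ 1 and J, ∑ ∏_{i=1}^{2M} C(2j_i, j_i) = 4^J · C(M+J−1, J), where the sum ranges over all tuples (j_1,…,j_{2M}) of nonnegative integers with j_1+⋯+j_{2M} = J. (This is the combinatorial identity underlying the negative-binomial form of the total photon-number distribution for m = 2M single-mode squeezed states.) -/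
open Finset in
theorem two_mul_sum_antidiagonal_fst_mul {R : Type*} [CommSemiring R] (f : ℕ → R) (n : ℕ) :
    2 * ∑ p ∈ antidiagonal n, p.1 * (f p.1 * f p.2) =
      n * ∑ p ∈ antidiagonal n, f p.1 * f p.2 := by
  have h : ∑ p ∈ antidiagonal n, (p.1 : R) * (f p.1 * f p.2) =
      ∑ p ∈ antidiagonal n, (p.2 : R) * (f p.1 * f p.2) := by
    rw [← Nat.sum_antidiagonal_swap]
    exact sum_congr rfl fun p _ ↦ by simp only [Prod.fst_swap, Prod.snd_swap]; ring
  rw [two_mul]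
  nth_rw 2 [h]
  rw [← sum_add_distrib, mul_sum]
  refine sum_congr rfl fun p hp ↦ ?_
  rw [← mem_antidiagonal.mp hp]
  push_cast
  ring

open Finset in
theorem sum_antidiagonal_centralBinom_mul (n : ℕ) :
    ∑ p ∈ antidiagonal n, p.1.centralBinom * p.2.centralBinom = 4 ^ n := by
  induction n with
  | zero => simp
  | succ n ih =>
    have h₁ := two_mul_sum_antidiagonal_fst_mul Nat.centralBinom n
    have h₂ := two_mul_sum_antidiagonal_fst_mul Nat.centralBinom (n + 1)
    have h₃ : ∑ p ∈ antidiagonal (n + 1), p.1 * (p.1.centralBinom * p.2.centralBinom) =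
        4 * ∑ p ∈ antidiagonal n, p.1 * (p.1.centralBinom * p.2.centralBinom) +
          2 * ∑ p ∈ antidiagonal n, p.1.centralBinom * p.2.centralBinom := by
      rw [Nat.sum_antidiagonal_succ, mul_sum, mul_sum, ← sum_add_distrib, zero_mul, zero_add]
      refine sum_congr rfl fun p _ ↦ ?_
      rw [← mul_assoc, Nat.succ_mul_centralBinom_succ]
      ring
    simp only [Nat.cast_id] at h₁ h₂
    rw [ih] at h₁ h₃
    refine Nat.eq_of_mul_eq_mul_left n.succ_pos ?_
    rw [Nat.succ_eq_add_one, ← h₂, h₃, pow_succ]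
    linarith

open PowerSeries in
theorem mk_centralBinom_sq (R : Type*) [CommRing R] :
    (mk fun n ↦ (n.centralBinom : R)) ^ 2 = rescale 4 (mk 1) := by
  ext n
  rw [sq, coeff_mul, coeff_rescale]
  simp only [coeff_mk, Pi.one_apply, mul_one]
  exact_mod_cast congrArg (Nat.cast : ℕ → R) (sum_antidiagonal_centralBinom_mul n)

open Finset PowerSeries in
theorem sum_antidiagonalTuple_prod {R : Type*} [CommSemiring R] (f : ℕ → R) (k n : ℕ) :
    ∑ t ∈ Nat.antidiagonalTuple k n, ∏ i, f (t i) = coeff n (mk f ^ k) := by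
  have h : mk f ^ k = ∏ _i : Fin k, mk f := by simp
  rw [h, coeff_prod]
  refine sum_equiv Finsupp.equivFunOnFinite.symm (fun t ↦ ?_) fun t _ ↦ ?_
  · simp [Nat.mem_antidiagonalTuple]
  · simp

/-- Combinatorial identity underlying the negative-binomial total photon-number distribution
for `m = 2M` single-mode squeezed states: for `M ≥ 1` and every `J`,
`∑_{j₁+⋯+j_{2M}=J} ∏_i C(2jᵢ, jᵢ) = 4^J · C(M+J−1, J)`. -/
theorem central_binom_convolution (M J : ℕ) (hM : 1 ≤ M) :
    ∑ t ∈ Finset.Nat.antidiagonalTuple (2 * M) J,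
        ∏ i, Nat.choose (2 * t i) (t i)
      = 4 ^ J * Nat.choose (M + J - 1) J := by
  obtain ⟨k, rfl⟩ := Nat.exists_eq_add_of_le' hM
  have h := sum_antidiagonalTuple_prod (fun n ↦ (n.centralBinom : ℤ)) (2 * (k + 1)) J
  rw [pow_mul, mk_centralBinom_sq, ← map_pow, PowerSeries.mk_one_pow_eq_mk_choose_add,
    PowerSeries.coeff_rescale, PowerSeries.coeff_mk] at h
  have hJ : k + 1 + J - 1 = k + J := by omega
  rw [hJ, ← Nat.choose_symm_add]
  exact_mod_cast h
end
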